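/- ∫_0^∞ x^9/(cos x + cosh x)^3 dx = 567Γ^12/(2^13 π^3) + 117Γ^20/(2^18 π^7) − 297Γ^20/(2^19 π^6) + 189Γ^20/(2^21 π^5) + 3Γ^28/(2^22 π^11), where Γ = Γ(1/4). -/

import Mathlib

open Real

namespace GaussLattice

open Filter Topology

/-- The period pair `(1, i)` generating the Gaussian integers. -/
noncomputable def periods : PeriodPair where
  ω₁ := 1
  ω₂ := Complex.I
  indep := by
    simpa using! Complex.basisOneI.linearIndependent

local notation "Λ" => periods.lattice

lemma mem_iff {z : ℂ} : z ∈ Λ ↔ ∃ m n : ℤ, (m : ℂ) + n * Complex.I = z := by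
  simp [PeriodPair.mem_lattice, periods]

lemma I_mul_mem {z : ℂ} (hz : z ∈ Λ) : Complex.I * z ∈ Λ := by
  obtain ⟨m, n, rfl⟩ := mem_iff.1 hz
  refine mem_iff.2 ⟨-n, m, ?_⟩
  push_cast
  linear_combination (-n : ℂ) * Complex.I_mul_I

lemma conj_mem {z : ℂ} (hz : z ∈ Λ) : (starRingEnd ℂ) z ∈ Λ := by
  obtain ⟨m, n, rfl⟩ := mem_iff.1 hz
  refine mem_iff.2 ⟨m, -n, ?_⟩
  simp

/-- Multiplication by `i` as a permutation of the lattice. -/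
noncomputable def mulI : Λ ≃ Λ where
  toFun l := ⟨Complex.I * l, I_mul_mem l.2⟩
  invFun l := ⟨-(Complex.I * l), neg_mem (I_mul_mem l.2)⟩
  left_inv l := by
    ext
    simp only
    linear_combination (-(l : ℂ)) * Complex.I_mul_I
  right_inv l := by
    ext
    simp only
    linear_combination (-(l : ℂ)) * Complex.I_mul_I

/-- Complex conjugation as a permutation of the lattice. -/
noncomputable def conjEquiv : Λ ≃ Λ where
  toFun l := ⟨(starRingEnd ℂ) l, conj_mem l.2⟩
  invFun l := ⟨(starRingEnd ℂ) l, conj_mem l.2⟩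
  left_inv l := by ext; simp
  right_inv l := by ext; simp

lemma I_mul_mem_iff {z : ℂ} : Complex.I * z ∈ Λ ↔ z ∈ Λ := by
  refine ⟨fun h => ?_, I_mul_mem⟩
  have := neg_mem (I_mul_mem h)
  rwa [← mul_assoc, Complex.I_mul_I, neg_one_mul, neg_neg] at this

lemma one_mem : (1 : ℂ) ∈ Λ := mem_iff.2 ⟨1, 0, by simp⟩

lemma I_mem : Complex.I ∈ Λ := mem_iff.2 ⟨0, 1, by simp⟩

lemma add_mem_iff {z : ℂ} (l : Λ) : z + l ∈ Λ ↔ z ∈ Λ :=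
  Submodule.add_mem_iff_left _ l.2

lemma one_le_norm {l : Λ} (hl : l ≠ 0) : 1 ≤ ‖(l : ℂ)‖ := by
  obtain ⟨m, n, h⟩ := mem_iff.1 l.2
  have h1 : 1 ≤ m * m + n * n := by
    by_contra! h2
    have hm : m = 0 := by nlinarith [mul_self_nonneg m, mul_self_nonneg n]
    have hn : n = 0 := by nlinarith [mul_self_nonneg m, mul_self_nonneg n]
    apply hl
    ext
    simp [← h, hm, hn]
  rw [← sq_le_sq₀ (by norm_num) (norm_nonneg _), ← Complex.normSq_eq_norm_sq, ← h,
    Complex.normSq_apply]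
  simp only [Complex.add_re, Complex.intCast_re, Complex.mul_re, Complex.I_re, mul_zero,
    Complex.intCast_im, Complex.I_im, mul_one, sub_self, add_zero, Complex.add_im, Complex.mul_im,
    zero_add, one_pow]
  exact_mod_cast h1

/-- The weighted lattice series `∑ c(l) / (1 + |l|) ^ k` converges absolutely. -/
def Admissible (c : Λ → ℂ) (k : ℕ) : Prop :=
  Summable fun l : Λ => ‖c l‖ / (1 + ‖(l : ℂ)‖) ^ k

lemma Admissible.succ {c : Λ → ℂ} {k : ℕ} (h : Admissible c k) : Admissible c (k + 1) := by
  refine h.of_nonneg_of_le (fun l => by positivity) fun l => ?_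
  gcongr
  · linarith [norm_nonneg (l : ℂ)]
  · omega

lemma Admissible.mono {c : Λ → ℂ} {k n : ℕ} (h : Admissible c k) (hn : k ≤ n) :
    Admissible c n := by
  induction n, hn using Nat.le_induction with
  | base => exact h
  | succ n _ ih => exact ih.succ

lemma admissible_of_le {c : Λ → ℂ} {k j : ℕ} (C : ℝ) (hc : ∀ l, ‖c l‖ ≤ C * (1 + ‖(l : ℂ)‖) ^ j)
    (hjk : j + 3 ≤ k) : Admissible c k := by
  have h0 : Summable fun l : Λ => C * ‖(l : ℂ)‖⁻¹ ^ (k - j) :=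
    (ZLattice.summable_norm_pow_inv Λ (k - j) (by simp; omega)).mul_left C
  refine Summable.of_norm_bounded_eventually h0 ?_
  refine (Set.finite_singleton (0 : Λ)).subset fun l hl => ?_
  by_contra hl0
  apply hl
  have h1 := one_le_norm hl0
  show ‖‖c l‖ / (1 + ‖(l : ℂ)‖) ^ k‖ ≤ C * ‖(l : ℂ)‖⁻¹ ^ (k - j)
  rw [Real.norm_of_nonneg (by positivity)]
  have hC : 0 ≤ C := by
    have := (norm_nonneg _).trans (hc 0)
    simpa using this
  calc ‖c l‖ / (1 + ‖(l : ℂ)‖) ^ k ≤ C * (1 + ‖(l : ℂ)‖) ^ j / (1 + ‖(l : ℂ)‖) ^ k := by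
        gcongr; exact hc l
    _ = C * (1 + ‖(l : ℂ)‖)⁻¹ ^ (k - j) := by
        rw [inv_pow, pow_sub₀ _ (by positivity) (by omega)]
        field_simp
    _ ≤ C * ‖(l : ℂ)‖⁻¹ ^ (k - j) := by
        gcongr
        linarith

/-- The lattice series `∑ c(l) / (z + l) ^ k`. -/
noncomputable def series (c : Λ → ℂ) (k : ℕ) (z : ℂ) : ℂ := ∑' l : Λ, c l / (z + l) ^ k

/-- `z` avoids the poles of the lattice series with coefficients `c`. -/
def Regular (c : Λ → ℂ) (z : ℂ) : Prop := ∀ l : Λ, c l ≠ 0 → z + l ≠ 0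

lemma regular_of_notMem {c : Λ → ℂ} {z : ℂ} (hz : z ∉ Λ) : Regular c z := fun l _ h => by
  apply hz
  rw [eq_neg_of_add_eq_zero_left h]
  exact neg_mem l.2

lemma regular_zero {c : Λ → ℂ} (hc : c 0 = 0) : Regular c 0 := fun l hl h => by
  apply hl
  rw [zero_add] at h
  rw [show l = 0 from Subtype.ext h, hc]

lemma Regular.exists_bound {c : Λ → ℂ} {z₀ : ℂ} (hz : Regular c z₀) :
    ∃ r > 0, ∃ C : ℝ, ∀ z ∈ Metric.ball z₀ r, ∀ l : Λ, c l ≠ 0 → 1 + ‖(l : ℂ)‖ ≤ C * ‖z + l‖ := by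
  have hcl : IsClosed {w : ℂ | ∃ l : Λ, c l ≠ 0 ∧ w = -l} := by
    refine periods.isClosed_of_subset_lattice ?_
    rintro w ⟨l, -, rfl⟩
    exact neg_mem l.2
  have hmem : z₀ ∈ {w : ℂ | ∃ l : Λ, c l ≠ 0 ∧ w = -l}ᶜ := by
    rintro ⟨l, hl, h⟩
    exact hz l hl (by simp [h])
  obtain ⟨δ, hδ, hball⟩ := Metric.isOpen_iff.1 hcl.isOpen_compl _ hmem
  refine ⟨δ / 2, by positivity, 2 * ((1 + ‖z₀‖) / δ + 1), fun z hzb l hl => ?_⟩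
  have h1 : δ ≤ ‖z₀ + l‖ := by
    by_contra! h
    have : -(l : ℂ) ∈ Metric.ball z₀ δ := by
      rw [Metric.mem_ball, dist_comm, dist_eq_norm]
      simpa using h
    exact hball this ⟨l, hl, rfl⟩
  rw [Metric.mem_ball, dist_eq_norm] at hzb
  have h2 : ‖z₀ + l‖ ≤ ‖z + l‖ + ‖z - z₀‖ := by
    have := norm_sub_le (z + l) (z - z₀)
    rwa [show z + l - (z - z₀) = z₀ + l by ring] at this
  have h3 : ‖z₀ + l‖ ≤ 2 * ‖z + l‖ := by linarith
  have h4 : ‖(l : ℂ)‖ ≤ ‖z₀ + l‖ + ‖z₀‖ := by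
    have := norm_sub_le (z₀ + l) z₀
    rwa [add_sub_cancel_left] at this
  have h5 : (1 + ‖z₀‖) ≤ (1 + ‖z₀‖) / δ * ‖z₀ + l‖ := by
    rw [div_mul_eq_mul_div, le_div_iff₀ hδ]
    gcongr
  calc 1 + ‖(l : ℂ)‖ ≤ (1 + ‖z₀‖) + ‖z₀ + l‖ := by linarith
    _ ≤ (1 + ‖z₀‖) / δ * ‖z₀ + l‖ + ‖z₀ + l‖ := by linarith
    _ = ((1 + ‖z₀‖) / δ + 1) * ‖z₀ + l‖ := by ring
    _ ≤ ((1 + ‖z₀‖) / δ + 1) * (2 * ‖z + l‖) := by gcongr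
    _ = 2 * ((1 + ‖z₀‖) / δ + 1) * ‖z + l‖ := by ring

lemma norm_div_pow_le {c z l : ℂ} {C : ℝ} (k : ℕ)
    (h : c ≠ 0 → 1 + ‖l‖ ≤ C * ‖z + l‖) :
    ‖c / (z + l) ^ k‖ ≤ C ^ k * (‖c‖ / (1 + ‖l‖) ^ k) := by
  by_cases hc : c = 0
  · simp [hc]
  have h1 := h hc
  have hpos : 0 < 1 + ‖l‖ := by positivity
  have h2 : 0 < ‖z + l‖ := by
    rcases (norm_nonneg (z + l)).eq_or_lt with h0 | h0
    · rw [← h0] at h1; linarith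
    · exact h0
  rw [norm_div, norm_pow, mul_div_assoc', div_le_div_iff₀ (by positivity) (by positivity)]
  calc ‖c‖ * (1 + ‖l‖) ^ k ≤ ‖c‖ * (C * ‖z + l‖) ^ k := by gcongr
    _ = C ^ k * ‖c‖ * ‖z + l‖ ^ k := by ring

lemma summable {c : Λ → ℂ} {k : ℕ} (hc : Admissible c k) {z : ℂ} (hz : Regular c z) :
    Summable fun l : Λ => c l / (z + l) ^ k := by
  obtain ⟨r, hr, C, hC⟩ := hz.exists_bound
  exact Summable.of_norm_bounded (hc.mul_left (C ^ k)) fun l =>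
    norm_div_pow_le k (hC z (Metric.mem_ball_self hr) l)

lemma hasDerivAt_series {c : Λ → ℂ} {k : ℕ} (hc : Admissible c k) {z : ℂ} (hz : Regular c z) :
    HasDerivAt (series c k) (-k * series c (k + 1) z) z := by
  obtain ⟨r, hr, C, hC⟩ := hz.exists_bound
  have hne : ∀ l : Λ, ∀ y ∈ Metric.ball z r, c l ≠ 0 → y + l ≠ 0 := by
    intro l y hy hl h0
    have := hC y hy l hl
    rw [h0, norm_zero, mul_zero] at this
    linarith [norm_nonneg (l : ℂ)]
  have key := hasDerivAt_tsum_of_isPreconnected (𝕜 := ℂ)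
    (g := fun (l : Λ) (y : ℂ) => c l / (y + l) ^ k)
    (g' := fun (l : Λ) (y : ℂ) => -k * (c l / (y + l) ^ (k + 1)))
    (u := fun l : Λ => k * (C ^ (k + 1) * (‖c l‖ / (1 + ‖(l : ℂ)‖) ^ (k + 1))))
    (t := Metric.ball z r) (y₀ := z) (y := z)
    ((hc.succ.mul_left _).mul_left _) Metric.isOpen_ball
    (convex_ball z r).isPreconnected ?_ ?_ (Metric.mem_ball_self hr) (summable hc hz)
    (Metric.mem_ball_self hr)
  · rw [tsum_mul_left] at key
    exact key
  · intro l y hy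
    by_cases hl : c l = 0
    · simpa [hl] using hasDerivAt_const y (0 : ℂ)
    have h0 := hne l y hy hl
    have h1 : HasDerivAt (fun y : ℂ => y + l) 1 y := (hasDerivAt_id y).add_const _
    convert! ((hasDerivAt_const y (c l)).div (h1.pow k) (pow_ne_zero _ h0)) using 1
    rcases k with _ | k
    · simp
    · simp only [Pi.pow_apply, Nat.add_sub_cancel]
      field_simp
      ring
  · intro l y hy
    rw [norm_mul, norm_neg, Complex.norm_natCast]
    gcongr
    exact norm_div_pow_le (k + 1) (hC y hy l)

lemma isOpen_regular (c : Λ → ℂ) : IsOpen {z | Regular c z} := by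
  rw [Metric.isOpen_iff]
  intro z hz
  obtain ⟨r, hr, C, hC⟩ := Regular.exists_bound hz
  refine ⟨r, hr, fun y hy l hl h0 => ?_⟩
  have := hC y hy l hl
  rw [h0, norm_zero, mul_zero] at this
  linarith [norm_nonneg (l : ℂ)]

lemma analyticAt_series {c : Λ → ℂ} {k : ℕ} (hc : Admissible c k) {z : ℂ} (hz : Regular c z) :
    AnalyticAt ℂ (series c k) z := by
  have h : DifferentiableOn ℂ (series c k) {z | Regular c z} := fun w hw =>
    (hasDerivAt_series hc hw).differentiableAt.differentiableWithinAt
  exact h.analyticAt ((isOpen_regular c).mem_nhds hz)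

lemma iteratedDeriv_series {c : Λ → ℂ} {k : ℕ} (hc : Admissible c k) (n : ℕ) {z : ℂ}
    (hz : Regular c z) :
    iteratedDeriv n (series c k) z = (-1) ^ n * (k.ascFactorial n) * series c (k + n) z := by
  induction n generalizing z with
  | zero => simp
  | succ n ih =>
    rw [iteratedDeriv_succ]
    have : iteratedDeriv n (series c k) =ᶠ[𝓝 z]
        fun z => (-1) ^ n * (k.ascFactorial n) * series c (k + n) z := by
      filter_upwards [(isOpen_regular c).mem_nhds hz] with w hw using ih hw
    rw [this.deriv_eq,
      ((hasDerivAt_series (hc.mono (Nat.le_add_right k n)) hz).const_mul _).deriv,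
      Nat.ascFactorial_succ]
    push_cast
    ring_nf

/-- Taylor expansion at `0` of a lattice series without pole there. -/
lemma series_taylor {c : Λ → ℂ} {k : ℕ} (hc : Admissible c k) (hc0 : c 0 = 0) (n : ℕ) :
    ∃ R : ℂ → ℂ, ContinuousAt R 0 ∧ ∀ z, series c k z =
      (∑ i ∈ Finset.range n,
        (-1) ^ i * ((k.ascFactorial i : ℂ) / i.factorial) * series c (k + i) 0 * z ^ i)
        + z ^ n * R z := by
  obtain ⟨R, hR, h⟩ := (analyticAt_series hc (regular_zero hc0)).exists_eq_sum_add_pow_mul n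
  refine ⟨R, hR.continuousAt, fun z => ?_⟩
  rw [h z]
  congr 1
  refine Finset.sum_congr rfl fun i _ => ?_
  rw [iteratedDeriv_series hc i (regular_zero hc0), smul_eq_mul]
  ring

lemma coe_mulI (l : Λ) : (mulI l : ℂ) = Complex.I * l := rfl

lemma series_I_mul {c : Λ → ℂ} {μ : ℂ} (h : ∀ l, c (mulI l) = μ * c l) (k : ℕ) (z : ℂ) :
    series c k (Complex.I * z) = μ / Complex.I ^ k * series c k z := by
  rw [series, series, ← tsum_mul_left, ← mulI.tsum_eq]
  refine tsum_congr fun l => ?_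
  rw [h, coe_mulI, ← mul_add, mul_pow, div_mul_div_comm]

lemma series_neg {c : Λ → ℂ} {μ : ℂ} (h : ∀ l, c (-l) = μ * c l) (k : ℕ) (z : ℂ) :
    series c k (-z) = μ / (-1) ^ k * series c k z := by
  rw [series, series, ← tsum_mul_left, ← (Equiv.neg Λ).tsum_eq]
  refine tsum_congr fun l => ?_
  rw [Equiv.neg_apply, h, NegMemClass.coe_neg, ← neg_add, neg_pow (z + (l : ℂ)), div_mul_div_comm]

/-- The coefficients `l⁻²` (vanishing at `l = 0`). -/
noncomputable def invSq (l : Λ) : ℂ := ((l : ℂ) ^ 2)⁻¹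

lemma invSq_zero : invSq 0 = 0 := by simp [invSq]

lemma admissible_invSq : Admissible invSq 1 := by
  refine Summable.of_nonneg_of_le (fun l => by positivity) (fun l => ?_)
    (ZLattice.summable_norm_pow_inv Λ 3 (by simp))
  by_cases hl : l = 0
  · simp [hl, invSq]
  have h1 := one_le_norm hl
  rw [invSq, norm_inv, norm_pow, pow_one, div_le_iff₀ (by positivity)]
  show _ ≤ ‖(l : ℂ)‖⁻¹ ^ 3 * _
  field_simp
  linarith

/-- The Weierstrass zeta function of the Gaussian integers. -/
noncomputable def zeta (z : ℂ) : ℂ := 1 / z + z ^ 2 * series invSq 1 z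

lemma zeta_neg (z : ℂ) : zeta (-z) = -zeta z := by
  rw [zeta, zeta, series_neg (μ := 1) (fun l => by simp [invSq])]
  rw [one_div_neg_eq_neg_one_div]
  ring

lemma zeta_I_mul (z : ℂ) : zeta (Complex.I * z) = -Complex.I * zeta z := by
  rw [zeta, zeta, series_I_mul (μ := -1) (fun l => by
    simp only [invSq, coe_mulI, mul_pow, Complex.I_sq, mul_inv]
    norm_num)]
  rw [pow_one, one_div, mul_inv, Complex.inv_I, mul_pow, Complex.I_sq, div_eq_mul_inv (-1),
    Complex.inv_I]
  ring

lemma ne_zero_of_notMem {z : ℂ} (hz : z ∉ Λ) : z ≠ 0 := fun h => hz (h ▸ zero_mem _)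

lemma add_ne_zero_of_notMem {z : ℂ} (hz : z ∉ Λ) (l : Λ) : z + l ≠ 0 := fun h => by
  apply hz
  rw [eq_neg_of_add_eq_zero_left h]
  exact neg_mem l.2

lemma weierstrassP_eq {z : ℂ} (hz : z ∉ Λ) : periods.weierstrassP z =
    1 / z ^ 2 - 2 * z * series invSq 1 z + z ^ 2 * series invSq 2 z := by
  have hr := regular_of_notMem (c := invSq) hz
  have hP := (periods.hasSum_weierstrassP z)
  rw [← (Equiv.neg Λ).hasSum_iff] at hP
  have hS := (((summable admissible_invSq hr).hasSum.mul_left (2 * z)).sub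
    ((summable admissible_invSq.succ hr).hasSum.mul_left (z ^ 2))).sub
      (hasSum_ite_eq (0 : Λ) (1 / z ^ 2))
  have hE := hP.neg.unique (hS.congr_fun ?_)
  · rw [← neg_inj, hE]
    simp only [series]
    ring
  · intro l
    simp only [Function.comp_apply, Equiv.neg_apply, NegMemClass.coe_neg, sub_neg_eq_add]
    have h3 := add_ne_zero_of_notMem hz l
    by_cases hl : l = 0
    · simp [hl, invSq]
    · have h4 : (l : ℂ) ≠ 0 := by simpa using hl
      rw [if_neg hl, invSq]
      field_simp
      ring

lemma hasDerivAt_zeta {z : ℂ} (hz : z ∉ Λ) :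
    HasDerivAt zeta (-periods.weierstrassP z) z := by
  have h0 := ne_zero_of_notMem hz
  have h1 := hasDerivAt_series admissible_invSq (regular_of_notMem (c := invSq) hz)
  have h2 : HasDerivAt zeta _ z :=
    ((hasDerivAt_const z (1 : ℂ)).div (hasDerivAt_id z) h0).add
      (((hasDerivAt_id z).pow 2).mul h1)
  convert h2 using 1
  rw [weierstrassP_eq hz]
  simp only [Pi.pow_apply, id]
  field_simp
  push_cast
  ring

lemma countable_lattice : (Λ : Set ℂ).Countable := by
  have : Countable Λ := periods.latticeEquivProd.toEquiv.countable_iff.2 inferInstance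
  exact Set.to_countable _

lemma isOpen_compl : IsOpen (Λ : Set ℂ)ᶜ := periods.isClosed_lattice.isOpen_compl

lemma isPreconnected_compl : IsPreconnected (Λ : Set ℂ)ᶜ :=
  (countable_lattice.isConnected_compl_of_one_lt_rank
    (by rw [Complex.rank_real_complex]; norm_num)).isPreconnected

lemma exists_zeta_add_eq (l : Λ) : ∃ η : ℂ, ∀ z ∉ Λ, zeta (z + l) = zeta z + η := by
  have key := isOpen_compl.exists_is_const_of_deriv_eq_zero isPreconnected_compl
    (f := fun z => zeta (z + l) - zeta z) ?_ ?_
  · obtain ⟨η, h⟩ := key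
    exact ⟨η, fun z hz => by rw [← h z hz]; ring⟩
  all_goals
    intro z hz
    have h1 := (hasDerivAt_zeta (mt (add_mem_iff l).1 hz)).comp_add_const z (l : ℂ)
    have h2 := h1.sub (hasDerivAt_zeta hz)
  · exact h2.differentiableAt.differentiableWithinAt
  · simpa using! h2.deriv

lemma regular_invSq_of_abs_le {z : ℂ} (h1 : |z.re| ≤ 1 / 2) (h2 : |z.im| ≤ 1 / 2) :
    Regular invSq z := by
  intro l hl h0
  have hl0 : l ≠ 0 := by
    rintro rfl
    exact hl invSq_zero
  have h3 := one_le_norm hl0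
  rw [eq_neg_of_add_eq_zero_right h0, norm_neg, ← sq_le_sq₀ (by norm_num) (norm_nonneg _),
    ← Complex.normSq_eq_norm_sq, Complex.normSq_apply] at h3
  nlinarith [abs_mul_abs_self z.re, abs_mul_abs_self z.im, abs_nonneg z.re, abs_nonneg z.im]

lemma notMem_of_re {z : ℂ} (h : z.re = 1 / 2 ∨ z.re = -1 / 2) : z ∉ Λ := by
  intro hz
  obtain ⟨m, n, rfl⟩ := mem_iff.1 hz
  simp only [Complex.add_re, Complex.intCast_re, Complex.mul_re, Complex.I_re, mul_zero,
    Complex.intCast_im, Complex.I_im, mul_one, sub_self, add_zero] at h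
  rcases h with h | h
  · have : ((2 * m : ℤ) : ℝ) = (1 : ℤ) := by push_cast; linarith
    have := Int.cast_injective this
    omega
  · have : ((2 * m : ℤ) : ℝ) = (-1 : ℤ) := by push_cast; linarith
    have := Int.cast_injective this
    omega

lemma notMem_of_im {z : ℂ} (h : z.im = 1 / 2 ∨ z.im = -1 / 2) : z ∉ Λ := by
  intro hz
  refine notMem_of_re (z := -(Complex.I * z)) ?_ (neg_mem (I_mul_mem hz))
  simpa using h

lemma integral_inv_sq_add_quarter :
    ∫ x in (-1 / 2 : ℝ)..(1 / 2), (1 / (x ^ 2 + 1 / 4) : ℝ) = π := by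
  have : ∀ x ∈ Set.uIcc (-1 / 2 : ℝ) (1 / 2),
      HasDerivAt (fun x : ℝ => 2 * arctan (2 * x)) (1 / (x ^ 2 + 1 / 4)) x := by
    intro x _
    have h := (((hasDerivAt_id x).const_mul 2).arctan).const_mul 2
    convert! h using 1
    simp only [id]
    field_simp
    ring
  rw [intervalIntegral.integral_eq_sub_of_hasDerivAt this]
  · norm_num
    ring
  · apply Continuous.intervalIntegrable
    fun_prop (disch := intro x; positivity)

lemma zeta_add_one_aux : ∃ η : ℂ, η = π ∧ ∀ z ∉ Λ, zeta (z + 1) = zeta z + η := by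
  obtain ⟨η₁, h₁⟩ := exists_zeta_add_eq ⟨1, one_mem⟩
  obtain ⟨η₂, h₂⟩ := exists_zeta_add_eq ⟨Complex.I, I_mem⟩
  simp only at h₁ h₂
  have h₂₁ : η₂ = -Complex.I * η₁ := by
    have hz : (1 / 2 : ℂ) ∉ Λ := notMem_of_re (by norm_num)
    have h := h₂ (Complex.I * (1 / 2)) (mt I_mul_mem_iff.1 hz)
    have h' : Complex.I * (1 / 2) + Complex.I = Complex.I * (1 / 2 + 1) := by ring
    rw [h', zeta_I_mul, zeta_I_mul, h₁ _ hz] at h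
    linear_combination -h
  refine ⟨η₁, ?_, h₁⟩
  set f : ℂ → ℂ := fun z => z ^ 2 * series invSq 1 z with hf
  have hfd : ∀ z : ℂ, |z.re| ≤ 1 / 2 → |z.im| ≤ 1 / 2 → DifferentiableAt ℂ f z := fun z hz1 hz2 =>
    (differentiableAt_id.pow 2).mul
      (hasDerivAt_series admissible_invSq (regular_invSq_of_abs_le hz1 hz2)).differentiableAt
  have hfz : ∀ z, f z = zeta z - 1 / z := fun z => by rw [hf, zeta]; ring
  have hrect := Complex.integral_boundary_rect_eq_zero_of_differentiableOn f
    (-1 / 2 + (-1 / 2 : ℝ) * Complex.I) (1 / 2 + (1 / 2 : ℝ) * Complex.I) ?_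
  swap
  · rintro z ⟨hz1, hz2⟩
    simp at hz1 hz2
    rw [Set.uIcc_of_le (by norm_num)] at hz1 hz2
    refine (hfd z ?_ ?_).differentiableWithinAt <;> rw [abs_le] <;> constructor
    · linarith [hz1.1]
    · linarith [hz1.2]
    · linarith [hz2.1]
    · linarith [hz2.2]
  have hcont : ∀ (a b : ℂ), (∀ x ∈ Set.uIcc (-1 / 2 : ℝ) (1 / 2),
      |(x * a + b).re| ≤ 1 / 2 ∧ |(x * a + b).im| ≤ 1 / 2) →
      IntervalIntegrable (fun x : ℝ => f (x * a + b)) MeasureTheory.volume (-1 / 2) (1 / 2) := by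
    intro a b hab
    refine ContinuousOn.intervalIntegrable fun x hx => ?_
    have h1 := (hfd _ (hab x hx).1 (hab x hx).2).continuousAt
    exact (ContinuousAt.comp (f := fun x : ℝ => (x * a + b : ℂ)) h1 (by fun_prop)).continuousWithinAt
  have hK : ∫ x in (-1 / 2 : ℝ)..(1 / 2), ((1 / (x ^ 2 + 1 / 4) : ℝ) : ℂ) = π := by
    rw [intervalIntegral.integral_ofReal, integral_inv_sq_add_quarter]
  have hKi : IntervalIntegrable (fun x : ℝ => ((1 / (x ^ 2 + 1 / 4) : ℝ) : ℂ))
      MeasureTheory.volume (-1 / 2) (1 / 2) := by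
    apply Continuous.intervalIntegrable
    fun_prop (disch := intro x; positivity)
  have hne : ∀ x : ℝ, (x : ℂ) ^ 2 + 1 / 4 ≠ 0 := fun x => by
    have := Complex.ofReal_ne_zero.2 (show x ^ 2 + 1 / 4 ≠ 0 by positivity)
    push_cast at this
    exact this
  have hside : ∀ a b b' η μ : ℂ, (∀ x ∈ Set.uIcc (-1 / 2 : ℝ) (1 / 2),
      |(x * a + b).re| ≤ 1 / 2 ∧ |(x * a + b).im| ≤ 1 / 2) → (∀ x ∈ Set.uIcc (-1 / 2 : ℝ) (1 / 2),
      |(x * a + b').re| ≤ 1 / 2 ∧ |(x * a + b').im| ≤ 1 / 2) →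
      (∀ x : ℝ, f (x * a + b) - f (x * a + b') = η - μ * (1 / (x ^ 2 + 1 / 4) : ℝ)) →
      (∫ x in (-1 / 2 : ℝ)..(1 / 2), f (x * a + b)) - ∫ x in (-1 / 2 : ℝ)..(1 / 2), f (x * a + b')
        = η - μ * π := by
    intro a b b' η μ h h' hd
    rw [← intervalIntegral.integral_sub (hcont _ _ h) (hcont _ _ h'),
      intervalIntegral.integral_congr (fun x _ => hd x),
      intervalIntegral.integral_sub (by simp) (hKi.const_mul _),
      intervalIntegral.integral_const_mul, hK, intervalIntegral.integral_const]
    norm_num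
  have hhor := hside 1 (((-1 / 2 : ℝ) : ℂ) * Complex.I) (((1 / 2 : ℝ) : ℂ) * Complex.I) (-η₂)
    Complex.I ?_ ?_ ?_
  have hver := hside Complex.I ((1 / 2 : ℝ) : ℂ) ((-1 / 2 : ℝ) : ℂ) η₁ 1 ?_ ?_ ?_
  · simp only [Complex.add_re, Complex.add_im, Complex.re_ofReal_mul, Complex.im_ofReal_mul,
      Complex.I_re, Complex.I_im, mul_zero, mul_one, add_zero] at hrect
    have e1 : (-1 / 2 : ℂ).re = -1 / 2 := by norm_num
    have e2 : (1 / 2 : ℂ).re = 1 / 2 := by norm_num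
    have e3 : (-1 / 2 : ℂ).im = 0 := by norm_num
    have e4 : (1 / 2 : ℂ).im = 0 := by norm_num
    simp only [e1, e2, e3, e4, zero_add, smul_eq_mul] at hrect
    simp only [mul_one, add_comm _ (Complex.ofReal _)] at hhor hver
    have h := Complex.I_ne_zero
    apply mul_left_cancel₀ h
    linear_combination (1 / 2 : ℂ) * hrect - (1 / 2 : ℂ) * hhor - (1 / 2 : ℂ) * Complex.I * hver
      + (1 / 2 : ℂ) * h₂₁
  · intro x hx
    rw [Set.uIcc_of_le (by norm_num)] at hx
    constructor
    · rw [abs_le]; constructor <;> simp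
    · rw [abs_le]; constructor <;> simp <;> linarith [hx.1, hx.2]
  · intro x hx
    rw [Set.uIcc_of_le (by norm_num)] at hx
    constructor
    · rw [abs_le]; constructor <;> simp <;> linarith [hx.1, hx.2]
    · rw [abs_le]; constructor <;> simp <;> linarith [hx.1, hx.2]
  · intro x
    have hz := h₁ (x * Complex.I + ((-1 / 2 : ℝ) : ℂ)) (notMem_of_re (Or.inr (by simp)))
    rw [hfz, hfz, show (x * Complex.I + ((1 / 2 : ℝ) : ℂ))
      = x * Complex.I + ((-1 / 2 : ℝ) : ℂ) + 1 by push_cast; ring, hz]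
    have hn := hne x
    have hp : (x * Complex.I + 1 / 2) * (-(x * Complex.I + -1 / 2)) = (x : ℂ) ^ 2 + 1 / 4 := by
      linear_combination (-(x : ℂ) ^ 2) * Complex.I_sq
    have n1 : (x * Complex.I + 1 / 2) ≠ 0 := fun h => hn (by rw [← hp, h, zero_mul])
    have n2 : (x * Complex.I + -1 / 2) ≠ 0 := fun h => hn (by rw [← hp, h, neg_zero, mul_zero])
    have hq : 1 / (x * Complex.I + 1 / 2) - 1 / (x * Complex.I + -1 / 2)
        = 1 / ((x : ℂ) ^ 2 + 1 / 4) := by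
      rw [div_sub_div _ _ n1 n2, div_eq_div_iff (mul_ne_zero n1 n2) hn]
      linear_combination hp
    push_cast
    rw [show x * Complex.I + -1 / 2 + 1 = x * Complex.I + 1 / 2 by ring, one_mul, ← hq]
    ring
  · intro x hx
    rw [Set.uIcc_of_le (by norm_num)] at hx
    constructor
    · rw [abs_le]; constructor <;> simp <;> linarith [hx.1, hx.2]
    · rw [abs_le]; constructor <;> simp <;> linarith [hx.1, hx.2]
  · intro x hx
    rw [Set.uIcc_of_le (by norm_num)] at hx
    constructor
    · rw [abs_le]; constructor <;> simp <;> linarith [hx.1, hx.2]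
    · rw [abs_le]; constructor <;> simp
  · intro x
    have hz := h₂ (x * 1 + ((-1 / 2 : ℝ) : ℂ) * Complex.I) (notMem_of_im (Or.inr (by simp)))
    rw [hfz, hfz, show (x * 1 + ((1 / 2 : ℝ) : ℂ) * Complex.I)
      = x * 1 + ((-1 / 2 : ℝ) : ℂ) * Complex.I + Complex.I by push_cast; ring, hz]
    have hn := hne x
    have hp : (x + 1 / 2 * Complex.I) * (x + -1 / 2 * Complex.I) = (x : ℂ) ^ 2 + 1 / 4 := by
      linear_combination (-1 / 4 : ℂ) * Complex.I_sq
    have n1 : (x + 1 / 2 * Complex.I) ≠ 0 := fun h => hn (by rw [← hp, h, zero_mul])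
    have n2 : (x + -1 / 2 * Complex.I) ≠ 0 := fun h => hn (by rw [← hp, h, mul_zero])
    have hq : 1 / (x + -1 / 2 * Complex.I) - 1 / (x + 1 / 2 * Complex.I)
        = Complex.I * (1 / ((x : ℂ) ^ 2 + 1 / 4)) := by
      rw [div_sub_div _ _ n2 n1, ← hp]
      field_simp
      ring
    push_cast
    rw [mul_one, show x + -1 / 2 * Complex.I + Complex.I = x + 1 / 2 * Complex.I by ring, ← hq]
    ring

lemma zeta_add_one {z : ℂ} (hz : z ∉ Λ) : zeta (z + 1) = zeta z + π := by
  obtain ⟨η, rfl, h⟩ := zeta_add_one_aux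
  exact h z hz

lemma zeta_add_I {z : ℂ} (hz : z ∉ Λ) : zeta (z + Complex.I) = zeta z - π * Complex.I := by
  have h1 : -(Complex.I * z) ∉ Λ := by rwa [neg_mem_iff, I_mul_mem_iff]
  have h := zeta_I_mul (-(Complex.I * z) + 1)
  rw [show Complex.I * (-(Complex.I * z) + 1) = z + Complex.I by
    linear_combination (-z) * Complex.I_sq, zeta_add_one h1, zeta_neg, zeta_I_mul] at h
  rw [h]
  linear_combination (-zeta z) * Complex.I_sq

/-- Quasi-periodicity of the zeta function, with the Legendre relation made explicit. -/
lemma zeta_add_coe {z : ℂ} (hz : z ∉ Λ) (l : Λ) :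
    zeta (z + l) = zeta z + π * (starRingEnd ℂ) l := by
  let S : AddSubgroup ℂ :=
    { carrier := {w | w ∈ Λ ∧ ∀ z ∉ Λ, zeta (z + w) = zeta z + π * (starRingEnd ℂ) w}
      zero_mem' := ⟨zero_mem _, fun z _ => by simp⟩
      add_mem' := fun {a b} ha hb => ⟨add_mem ha.1 hb.1, fun z hz => by
        rw [← add_assoc, hb.2 _ (mt (add_mem_iff ⟨a, ha.1⟩).1 hz), ha.2 z hz, map_add]
        ring⟩
      neg_mem' := fun {a} ha => ⟨neg_mem ha.1, fun z hz => by
        have h := ha.2 (z + -a) (mt (add_mem_iff ⟨-a, neg_mem ha.1⟩).1 hz)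
        rw [neg_add_cancel_right] at h
        rw [h, map_neg]
        ring⟩ }
  have h1 : (1 : ℂ) ∈ S := ⟨one_mem, fun z hz => by simp [zeta_add_one hz]⟩
  have hI : Complex.I ∈ S := ⟨I_mem, fun z hz => by
    rw [zeta_add_I hz, Complex.conj_I]
    ring⟩
  obtain ⟨m, n, h⟩ := mem_iff.1 l.2
  have h2 : (l : ℂ) ∈ S := by
    rw [← h]
    have := S.add_mem (S.zsmul_mem h1 m) (S.zsmul_mem hI n)
    simpa using this
  exact h2.2 z hz

lemma half_notMem : (1 / 2 : ℂ) ∉ Λ := notMem_of_re (by norm_num)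

lemma zeta_half : zeta (1 / 2) = π / 2 := by
  have h := zeta_add_one (z := -(1 / 2)) (by rw [neg_mem_iff]; exact half_notMem)
  rw [zeta_neg, show -(1 / 2) + 1 = (1 / 2 : ℂ) by norm_num] at h
  linear_combination (1 / 2 : ℂ) * h

lemma eventually_two_mul_notMem (s : ℂ) : ∀ᶠ z in 𝓝[≠] s, 2 * z ∉ Λ := by
  have h := periods.compl_lattice_sdiff_singleton_mem_nhds (2 * s)
  have h2 : Tendsto (fun z : ℂ => 2 * z) (𝓝 s) (𝓝 (2 * s)) := by
    exact (continuous_const.mul continuous_id).tendsto s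
  filter_upwards [(h2.eventually h).filter_mono nhdsWithin_le_nhds, self_mem_nhdsWithin]
    with z hz hne hmem
  exact hz ⟨hmem, fun h => hne (mul_left_cancel₀ two_ne_zero h)⟩

/-- Liouville's theorem: an elliptic function with singularities in `S`, where it tends to `c`,
is constant. -/
lemma eq_of_periodic {S : Set ℂ} (hS : ∀ z ∈ S, 2 * z ∈ Λ) (h0 : (0 : ℂ) ∈ S)
    (hSper : ∀ z : ℂ, ∀ l : Λ, z + l ∈ S ↔ z ∈ S) {f : ℂ → ℂ} {c : ℂ}
    (hf : ∀ z ∉ S, DifferentiableAt ℂ f z) (hper : ∀ z ∉ S, ∀ l : Λ, f (z + l) = f z)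
    (hlim : ∀ s ∈ S, Tendsto f (𝓝[≠] s) (𝓝 c)) {z : ℂ} (hz : z ∉ S) : f z = c := by
  classical
  set F : ℂ → ℂ := fun z => if z ∈ S then c else f z with hF
  have hne : ∀ s, ∀ᶠ z in 𝓝[≠] s, F z = f z ∧ z ∉ S := fun s => by
    filter_upwards [eventually_two_mul_notMem s] with z hz
    have : z ∉ S := fun h => hz (hS z h)
    exact ⟨if_neg this, this⟩
  have hd1 : ∀ s ∉ S, DifferentiableAt ℂ F s := fun s hs => by
    have : F =ᶠ[𝓝 s] f := by
      have h := (eventually_nhdsWithin_iff.1 (hne s))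
      filter_upwards [h] with z hz
      by_cases hzs : z = s
      · rw [hzs]; exact if_neg hs
      · exact (hz hzs).1
    exact (hf s hs).congr_of_eventuallyEq this
  have hd : Differentiable ℂ F := fun s => by
    by_cases hs : s ∈ S
    · refine (Complex.analyticAt_of_differentiable_on_punctured_nhds_of_continuousAt ?_
        ?_).differentiableAt
      · filter_upwards [hne s] with z hz using hd1 z hz.2
      · rw [continuousAt_iff_punctured_nhds]
        have : F s = c := if_pos hs
        rw [this]
        exact (hlim s hs).congr' ((hne s).mono fun z hz => hz.1.symm)
    · exact hd1 s hs
  have hFper : ∀ z, ∀ w ∈ Λ, F (z + w) = F z := fun z w hw => by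
    by_cases h : z ∈ S
    · rw [hF]
      simp only
      rw [if_pos h, if_pos ((hSper z ⟨w, hw⟩).2 h)]
    · rw [hF]
      simp only
      rw [if_neg h, if_neg (mt (hSper z ⟨w, hw⟩).1 h), hper z h ⟨w, hw⟩]
  have hb : Bornology.IsBounded (Set.range F) :=
    (IsZLattice.isCompact_range_of_periodic Λ F hd.continuous
      (fun z w hw => hFper z w hw)).isBounded
  have := hd.apply_eq_apply_of_bounded hb z 0
  rw [hF] at this
  simp only [if_neg hz, if_pos h0] at this
  exact this

lemma eq_zero_of_elliptic {f : ℂ → ℂ} (hf : ∀ z ∉ Λ, DifferentiableAt ℂ f z)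
    (hper : ∀ z ∉ Λ, ∀ l : Λ, f (z + l) = f z) {Q : ℂ → ℂ} (hQ : ContinuousAt Q 0)
    (h : ∀ z ∉ Λ, f z = z * Q z) : (∀ z ∉ Λ, f z = 0) ∧ Q 0 = 0 := by
  have hev : ∀ᶠ z in 𝓝[≠] (0 : ℂ), z ∉ Λ := (eventually_two_mul_notMem 0).mono fun z hz hmem => by
    rw [two_mul] at hz
    exact hz (add_mem hmem hmem)
  have h0 : Tendsto f (𝓝[≠] 0) (𝓝 0) := by
    have h1 : ContinuousAt (fun z => z * Q z) 0 := continuousAt_id.mul hQ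
    have h2 : Tendsto (fun z => z * Q z) (𝓝[≠] 0) (𝓝 0) := by
      simpa using h1.tendsto.mono_left nhdsWithin_le_nhds
    exact h2.congr' (hev.mono fun z hz => (h z hz).symm)
  have key : ∀ z ∉ Λ, f z = 0 := fun z hz => by
    refine eq_of_periodic (S := Λ) (fun z hz => by rw [two_mul]; exact add_mem hz hz)
      (zero_mem _) (fun z l => add_mem_iff l) hf hper (fun s hs => ?_) hz
    have h1 : Tendsto (fun z => z - s) (𝓝[≠] s) (𝓝[≠] 0) := by
      refine tendsto_nhdsWithin_iff.2 ⟨?_, ?_⟩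
      · have : ContinuousAt (fun z => z - s) s := by fun_prop
        simpa using this.tendsto.mono_left nhdsWithin_le_nhds
      · filter_upwards [self_mem_nhdsWithin] with z hz
        simpa [sub_eq_zero] using hz
    refine (h0.comp h1).congr' ?_
    filter_upwards [h1.eventually hev] with z hz
    have := hper (z - s) hz ⟨s, hs⟩
    simpa using this.symm
  refine ⟨key, ?_⟩
  have h1 : Tendsto Q (𝓝[≠] 0) (𝓝 (Q 0)) := hQ.tendsto.mono_left nhdsWithin_le_nhds
  refine tendsto_nhds_unique h1 (tendsto_const_nhds.congr' ?_)
  filter_upwards [hev] with z hz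
  have := h z hz
  rw [key z hz] at this
  exact (mul_eq_zero.1 this.symm).resolve_left (ne_zero_of_notMem hz) |>.symm

/-- The coefficients `l̄ ^ j` for `l ≠ 0`. -/
noncomputable def conjPow (j : ℕ) (l : Λ) : ℂ := if l = 0 then 0 else (starRingEnd ℂ) l ^ j

lemma conjPow_zero (j : ℕ) : conjPow j 0 = 0 := if_pos rfl

lemma norm_conjPow_le (j : ℕ) (l : Λ) : ‖conjPow j l‖ ≤ (1 + ‖(l : ℂ)‖) ^ j := by
  rw [conjPow]
  split_ifs
  · rw [norm_zero]; positivity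
  · rw [norm_pow, Complex.norm_conj]
    gcongr
    linarith

lemma admissible_conjPow {j k : ℕ} (h : j + 3 ≤ k) : Admissible (conjPow j) k :=
  admissible_of_le 1 (fun l => by simpa using norm_conjPow_le j l) h

lemma admissible_one {k : ℕ} (h : 3 ≤ k) : Admissible (fun _ => 1) k :=
  admissible_of_le (j := 0) 1 (fun l => by simp) (by omega)

lemma mulI_eq_zero {l : Λ} : mulI l = 0 ↔ l = 0 := by
  rw [← Subtype.coe_inj, ← Subtype.coe_inj (a := l), coe_mulI]
  simp

lemma conjPow_mulI (j : ℕ) (l : Λ) : conjPow j (mulI l) = Complex.I ^ (3 * j) * conjPow j l := by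
  rw [conjPow, conjPow]
  simp only [mulI_eq_zero]
  split_ifs
  · simp
  · rw [coe_mulI, map_mul, Complex.conj_I, mul_pow, pow_mul, Complex.I_pow_three]

/-- The lattice sums `∑ l̄ ^ j / l ^ s` over nonzero `l`. -/
noncomputable def latticeSum (s j : ℕ) : ℂ := series (conjPow j) s 0

lemma I_pow_eq_one_iff (n : ℕ) : Complex.I ^ n = 1 ↔ 4 ∣ n := by
  constructor
  · intro h
    have h4 : n % 4 < 4 := Nat.mod_lt _ (by norm_num)
    rw [Complex.I_pow_eq_pow_mod] at h
    rw [Nat.dvd_iff_mod_eq_zero]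
    generalize n % 4 = m at *
    interval_cases m
    · rfl
    · rw [pow_one] at h; simpa using congrArg Complex.re h
    · rw [Complex.I_sq] at h; norm_num at h
    · rw [Complex.I_pow_three] at h; simpa using congrArg Complex.re h
  · rintro ⟨m, rfl⟩
    rw [pow_mul, Complex.I_pow_four, one_pow]

lemma latticeSum_eq_zero {s j : ℕ} (h : ¬ 4 ∣ s + j) : latticeSum s j = 0 := by
  have h1 := series_I_mul (conjPow_mulI j) s 0
  rw [mul_zero] at h1
  have h2 : Complex.I ^ (3 * j) / Complex.I ^ s ≠ 1 := by
    intro h3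
    rw [div_eq_one_iff_eq (pow_ne_zero _ Complex.I_ne_zero)] at h3
    apply h
    rw [← I_pow_eq_one_iff, pow_add, ← h3, ← pow_add, show 3 * j + j = 4 * j by ring, pow_mul,
      Complex.I_pow_four, one_pow]
  by_contra h0
  exact h2 (mul_right_cancel₀ h0 (by rw [one_mul]; exact h1.symm))

lemma conjPow_series_taylor (j k a : ℕ) (hjk : j + 3 ≤ k) (ha : a < 4) (h : 4 ∣ j + k + a) :
    ∃ R : ℂ → ℂ, ContinuousAt R 0 ∧ ∀ z, series (conjPow j) k z =
      z ^ a * ((-1) ^ a * ((k.ascFactorial a : ℂ) / a.factorial) * latticeSum (k + a) j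
        + z ^ 4 * R z) := by
  obtain ⟨R, hR, hT⟩ := series_taylor (admissible_conjPow hjk) (conjPow_zero j) (a + 4)
  refine ⟨R, hR, fun z => ?_⟩
  rw [hT z, Finset.sum_eq_single_of_mem a (by simp)]
  · rw [latticeSum]
    ring
  · intro i hi hia
    rw [Finset.mem_range] at hi
    have : series (conjPow j) (k + i) 0 = 0 := latticeSum_eq_zero (by omega)
    rw [this]
    ring

lemma series_invSq_zero (i : ℕ) : series invSq i 0 = latticeSum (i + 2) 0 := by
  refine tsum_congr fun l => ?_
  by_cases hl : l = 0
  · simp [hl, conjPow, invSq]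
  · rw [invSq, conjPow, if_neg hl, zero_add, pow_zero, pow_add, div_eq_mul_inv, ← mul_inv, mul_comm,
      one_div]

/-- The Taylor polynomial of `z ζ(z)` as a polynomial in `z ^ 4`. -/
lemma zeta_taylor : ∃ R : ℂ → ℂ, ContinuousAt R 0 ∧ ∀ z ≠ 0, z * zeta z =
    1 - latticeSum 4 0 * z ^ 4 - latticeSum 8 0 * z ^ 8 - latticeSum 12 0 * z ^ 12
      + z ^ 16 * R z := by
  obtain ⟨R, hR, hT⟩ := series_taylor admissible_invSq invSq_zero 13
  refine ⟨R, hR, fun z hz => ?_⟩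
  rw [zeta, hT z]
  simp only [Finset.sum_range_succ, Finset.sum_range_zero, series_invSq_zero, Nat.one_ascFactorial,
    div_self (Nat.cast_ne_zero.2 (Nat.factorial_ne_zero _) : ((Nat.factorial _ : ℕ) : ℂ) ≠ 0)]
  norm_num
  rw [latticeSum_eq_zero (s := 3) (by norm_num), latticeSum_eq_zero (s := 5) (by norm_num),
    latticeSum_eq_zero (s := 6) (by norm_num), latticeSum_eq_zero (s := 7) (by norm_num),
    latticeSum_eq_zero (s := 9) (by norm_num), latticeSum_eq_zero (s := 10) (by norm_num),
    latticeSum_eq_zero (s := 11) (by norm_num), latticeSum_eq_zero (s := 13) (by norm_num),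
    latticeSum_eq_zero (s := 14) (by norm_num), latticeSum_eq_zero (s := 15) (by norm_num)]
  field_simp
  ring

lemma weierstrassP_taylor : ∃ R : ℂ → ℂ, ContinuousAt R 0 ∧ ∀ z ∉ Λ,
    z ^ 2 * periods.weierstrassP z = 1 + 3 * latticeSum 4 0 * z ^ 4 + 7 * latticeSum 8 0 * z ^ 8
      + 11 * latticeSum 12 0 * z ^ 12 + z ^ 16 * R z := by
  obtain ⟨R, hR, hT⟩ := series_taylor admissible_invSq invSq_zero 13
  obtain ⟨R', hR', hT'⟩ := series_taylor admissible_invSq.succ invSq_zero 12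
  refine ⟨fun z => -2 * R z + R' z, by fun_prop, fun z hz => ?_⟩
  have h0 := ne_zero_of_notMem hz
  rw [weierstrassP_eq hz, hT z, hT' z]
  simp only [Finset.sum_range_succ, Finset.sum_range_zero, series_invSq_zero, Nat.one_ascFactorial,
    div_self (Nat.cast_ne_zero.2 (Nat.factorial_ne_zero _) : ((Nat.factorial _ : ℕ) : ℂ) ≠ 0),
    Nat.ascFactorial, Nat.factorial]
  norm_num
  rw [latticeSum_eq_zero (s := 3) (by norm_num), latticeSum_eq_zero (s := 5) (by norm_num),
    latticeSum_eq_zero (s := 6) (by norm_num), latticeSum_eq_zero (s := 7) (by norm_num),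
    latticeSum_eq_zero (s := 9) (by norm_num), latticeSum_eq_zero (s := 10) (by norm_num),
    latticeSum_eq_zero (s := 11) (by norm_num), latticeSum_eq_zero (s := 13) (by norm_num),
    latticeSum_eq_zero (s := 14) (by norm_num), latticeSum_eq_zero (s := 15) (by norm_num)]
  field_simp
  ring

/-- The elliptic functions `∑ 1 / (z + l) ^ k`. -/
noncomputable def eis (k : ℕ) (z : ℂ) : ℂ := series (fun _ => 1) k z

lemma eis_eq {k : ℕ} (hk : 3 ≤ k) {z : ℂ} (hz : z ∉ Λ) :
    eis k z = 1 / z ^ k + series (conjPow 0) k z := by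
  have h1 := (summable (admissible_conjPow (j := 0) (by omega : 0 + 3 ≤ k))
    (regular_of_notMem hz)).hasSum.add (hasSum_ite_eq (0 : Λ) (1 / z ^ k))
  rw [eis, series, series, add_comm, ← h1.tsum_eq]
  refine tsum_congr fun l => ?_
  by_cases hl : l = 0
  · simp [hl, conjPow]
  · simp [hl, conjPow]

lemma eis_add_coe (k : ℕ) (z : ℂ) (l : Λ) : eis k (z + l) = eis k z := by
  rw [eis, eis, series, series,
    ← (Equiv.addLeft l).tsum_eq fun m : Λ => 1 / (z + (m : ℂ)) ^ k]
  refine tsum_congr fun m => ?_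
  rw [Equiv.coe_addLeft, Submodule.coe_add, add_assoc]

lemma hasDerivAt_eis {k : ℕ} (hk : 3 ≤ k) {z : ℂ} (hz : z ∉ Λ) :
    HasDerivAt (eis k) (-k * eis (k + 1) z) z :=
  hasDerivAt_series (admissible_one hk) (regular_of_notMem hz)

lemma differentiableAt_weierstrassP {z : ℂ} (hz : z ∉ Λ) :
    DifferentiableAt ℂ periods.weierstrassP z :=
  (periods.differentiableOn_weierstrassP z hz).differentiableAt (isOpen_compl.mem_nhds hz)

/-- The elliptic functions `∑ (ζ(z) + π l̄) ^ j / (z + l) ^ k`. -/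
noncomputable def mix (k j : ℕ) (z : ℂ) : ℂ :=
  ∑' l : Λ, (zeta z + π * (starRingEnd ℂ) l) ^ j / (z + l) ^ k

lemma mix_add_coe (k j : ℕ) {z : ℂ} (hz : z ∉ Λ) (l : Λ) : mix k j (z + l) = mix k j z := by
  rw [mix, mix, zeta_add_coe hz, ← (Equiv.addLeft l).tsum_eq fun m : Λ =>
    (zeta z + π * (starRingEnd ℂ) (m : ℂ)) ^ j / (z + m) ^ k]
  refine tsum_congr fun m => ?_
  rw [Equiv.coe_addLeft, Submodule.coe_add, add_assoc, add_assoc, map_add, mul_add]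

lemma mix_eq {k j : ℕ} (h : j + 3 ≤ k) {z : ℂ} (hz : z ∉ Λ) :
    mix k j z = zeta z ^ j / z ^ k + ∑ r ∈ Finset.range (j + 1),
      (j.choose r : ℂ) * π ^ r * zeta z ^ (j - r) * series (conjPow r) k z := by
  have h1 := (hasSum_ite_eq (0 : Λ) (zeta z ^ j / z ^ k)).add
    (hasSum_sum (s := Finset.range (j + 1)) fun r hr =>
    ((summable (admissible_conjPow (j := r) (k := k) (by rw [Finset.mem_range] at hr; omega))
    (regular_of_notMem hz)).hasSum.mul_left ((j.choose r : ℂ) * π ^ r * zeta z ^ (j - r))))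
  rw [mix]
  simp only [series]
  rw [← h1.tsum_eq]
  refine tsum_congr fun l => ?_
  by_cases hl : l = 0
  · simp [hl, conjPow]
  · simp only [hl, if_false, conjPow, zero_add]
    rw [add_comm (zeta z), add_pow, Finset.sum_div]
    refine Finset.sum_congr rfl fun r _ => ?_
    ring

lemma differentiableAt_mix {k j : ℕ} (h : j + 3 ≤ k) {z : ℂ} (hz : z ∉ Λ) :
    DifferentiableAt ℂ (mix k j) z := by
  have hzeta := (hasDerivAt_zeta hz).differentiableAt
  have h1 : DifferentiableAt ℂ (fun z => zeta z ^ j / z ^ k + ∑ r ∈ Finset.range (j + 1),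
      (j.choose r : ℂ) * π ^ r * zeta z ^ (j - r) * series (conjPow r) k z) z := by
    refine ((hzeta.pow j).div (differentiableAt_id.pow k)
      (pow_ne_zero _ (ne_zero_of_notMem hz))).add (DifferentiableAt.fun_sum fun r hr => ?_)
    rw [Finset.mem_range] at hr
    exact ((differentiableAt_const _).mul (hzeta.pow _)).mul
      (hasDerivAt_series (admissible_conjPow (by omega)) (regular_of_notMem hz)).differentiableAt
  refine h1.congr_of_eventuallyEq ?_
  filter_upwards [isOpen_compl.mem_nhds hz] with w hw using mix_eq h hw

lemma conj_half : (starRingEnd ℂ) (1 / 2 : ℂ) = 1 / 2 := by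
  rw [map_div₀, map_one, map_ofNat]

lemma mix_half (k j : ℕ) : mix k j (1 / 2) =
    π ^ j * ∑' l : Λ, (starRingEnd ℂ) (1 / 2 + l) ^ j / (1 / 2 + l : ℂ) ^ k := by
  rw [mix, zeta_half, ← tsum_mul_left]
  refine tsum_congr fun l => ?_
  rw [map_add, conj_half, mul_div_assoc', ← mul_pow]
  ring_nf

local notation "G₄" => latticeSum 4 0
local notation "G₈" => latticeSum 8 0
local notation "G₁₂" => latticeSum 12 0
local notation "A₁" => latticeSum 11 1
local notation "A₂" => latticeSum 10 2

/-- Truncations of `z ζ(z)` and of its powers, as polynomials in `z ^ 4`. -/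
lemma zeta_jet : ∃ t v U V : ℂ → ℂ, (ContinuousAt t 0 ∧ ContinuousAt v 0 ∧ ContinuousAt U 0 ∧
    ContinuousAt V 0) ∧ ∀ z ≠ 0, zeta z = (1 + z ^ 4 * t z) / z ∧
    1 + z ^ 4 * t z = 1 - G₄ * z ^ 4 - G₈ * z ^ 8 + z ^ 12 * (-G₁₂ + z ^ 4 * v z) ∧
    (1 + z ^ 4 * t z) ^ 2 = 1 - 2 * G₄ * z ^ 4 + (G₄ ^ 2 - 2 * G₈) * z ^ 8
      + z ^ 12 * (2 * G₄ * G₈ - 2 * G₁₂ + z ^ 4 * U z) ∧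
    (1 + z ^ 4 * t z) ^ 4 = 1 - 4 * G₄ * z ^ 4 + (6 * G₄ ^ 2 - 4 * G₈) * z ^ 8
      + (12 * G₄ * G₈ - 4 * G₄ ^ 3 - 4 * G₁₂) * z ^ 12 + z ^ 16 * V z := by
  obtain ⟨R, hR, hT⟩ := zeta_taylor
  refine ⟨fun z => -G₄ - G₈ * z ^ 4 - G₁₂ * z ^ 8 + z ^ 12 * R z, R,
    fun z => G₈ ^ 2 + 2 * G₄ * G₁₂ + 2 * R z + z ^ 4 * (2 * G₈ * G₁₂ - 2 * G₄ * R z)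
      + z ^ 8 * (G₁₂ ^ 2 - 2 * G₈ * R z) - 2 * z ^ 12 * G₁₂ * R z + z ^ 16 * R z ^ 2,
    fun z => 2 * (G₈ ^ 2 + 2 * G₄ * G₁₂ + 2 * R z + z ^ 4 * (2 * G₈ * G₁₂ - 2 * G₄ * R z)
      + z ^ 8 * (G₁₂ ^ 2 - 2 * G₈ * R z) - 2 * z ^ 12 * G₁₂ * R z + z ^ 16 * R z ^ 2)
      + (G₄ ^ 2 - 2 * G₈) ^ 2
      + (2 * G₄ * G₈ - 2 * G₁₂ + z ^ 4 * (G₈ ^ 2 + 2 * G₄ * G₁₂ + 2 * R z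
      + z ^ 4 * (2 * G₈ * G₁₂ - 2 * G₄ * R z)
      + z ^ 8 * (G₁₂ ^ 2 - 2 * G₈ * R z) - 2 * z ^ 12 * G₁₂ * R z + z ^ 16 * R z ^ 2)) *
      (-4 * G₄ + 2 * (G₄ ^ 2 - 2 * G₈) * z ^ 4 + z ^ 8 * (2 * G₄ * G₈ - 2 * G₁₂
      + z ^ 4 * (G₈ ^ 2 + 2 * G₄ * G₁₂ + 2 * R z + z ^ 4 * (2 * G₈ * G₁₂ - 2 * G₄ * R z)
      + z ^ 8 * (G₁₂ ^ 2 - 2 * G₈ * R z) - 2 * z ^ 12 * G₁₂ * R z + z ^ 16 * R z ^ 2))),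
    ⟨by fun_prop, hR, by fun_prop, by fun_prop⟩, fun z hz => ⟨?_, ?_, ?_, ?_⟩⟩
  · rw [eq_div_iff hz, mul_comm, hT z hz]
    ring
  · ring
  · ring
  · ring

lemma conjPow_series_leading (j k a : ℕ) (hk : j + 3 ≤ k) (ha : a < 4) (h : 4 ∣ j + k + a) :
    ∃ R : ℂ → ℂ, ContinuousAt R 0 ∧ (R 0 = (-1) ^ a * ((k.ascFactorial a : ℂ) / a.factorial)
      * latticeSum (k + a) j) ∧ ∀ z, series (conjPow j) k z = z ^ a * R z := by
  obtain ⟨R, hR, hT⟩ := conjPow_series_taylor j k a hk ha h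
  exact ⟨fun z => (-1) ^ a * ((k.ascFactorial a : ℂ) / a.factorial)
      * latticeSum (k + a) j + z ^ 4 * R z, by fun_prop, by simp, hT⟩

lemma mix_ten_one : 65 * G₁₂ - 10 * π * A₁ - 10 * G₄ * G₈ = 0 := by
  obtain ⟨t, v, U, V, ⟨ht, hv, hU, hV⟩, hz⟩ := zeta_jet
  obtain ⟨R1, hR1, hR10, hR1z⟩ := conjPow_series_leading 0 10 2 (by norm_num) (by norm_num)
    (by norm_num)
  obtain ⟨R2, hR2, hR20, hR2z⟩ := conjPow_series_leading 1 10 1 (by norm_num) (by norm_num)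
    (by norm_num)
  obtain ⟨R3, hR3, hR30, hR3z⟩ := conjPow_series_leading 0 11 1 (by norm_num) (by norm_num)
    (by norm_num)
  obtain ⟨R4, hR4, hR40, hR4z⟩ := conjPow_series_leading 0 7 1 (by norm_num) (by norm_num)
    (by norm_num)
  obtain ⟨R5, hR5, hR50, hR5z⟩ := conjPow_series_leading 0 3 1 (by norm_num) (by norm_num)
    (by norm_num)
  norm_num [Nat.ascFactorial, Nat.factorial] at hR10 hR20 hR30 hR40 hR50
  have key := eq_zero_of_elliptic
    (f := fun z => mix 10 1 z - eis 11 z + G₄ * eis 7 z + G₈ * eis 3 z)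
    (Q := fun z => (-G₁₂ + z ^ 4 * v z) + (1 + z ^ 4 * t z) * R1 z + π * R2 z - R3 z + G₄ * R4 z
      + G₈ * R5 z)
    ?_ ?_ (by fun_prop) ?_
  · have h := key.2
    simp only [hR10, hR20, hR30, hR40, hR50] at h
    linear_combination h
  · intro z hz
    have := differentiableAt_mix (k := 10) (j := 1) (by norm_num) hz
    have := (hasDerivAt_eis (k := 11) (by norm_num) hz).differentiableAt
    have := (hasDerivAt_eis (k := 7) (by norm_num) hz).differentiableAt
    have := (hasDerivAt_eis (k := 3) (by norm_num) hz).differentiableAt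
    fun_prop
  · intro z hz l
    simp only [mix_add_coe _ _ hz, eis_add_coe]
  · intro z hzL
    have h0 := ne_zero_of_notMem hzL
    obtain ⟨e1, e2, e3, e4⟩ := hz z h0
    simp only [mix_eq (k := 10) (j := 1) (by norm_num) hzL,
      eis_eq (k := 11) (by norm_num) hzL,
      eis_eq (k := 7) (by norm_num) hzL,
      eis_eq (k := 3) (by norm_num) hzL,
      Finset.sum_range_succ, Finset.sum_range_zero, hR1z, hR2z, hR3z, hR4z, hR5z, e1,
      Nat.choose]
    norm_num
    field_simp
    linear_combination e2

lemma mix_nine_two : 2 * G₄ * G₈ - 2 * G₁₂ - 165 * G₁₂ + 90 * π * A₁ - 9 * π ^ 2 * A₂ + 11 * G₁₂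
    - 14 * G₄ * G₈ + 3 * (G₄ ^ 2 - 2 * G₈) * G₄ = 0 := by
  obtain ⟨t, v, U, V, ⟨ht, hv, hU, hV⟩, hz⟩ := zeta_jet
  obtain ⟨R1, hR1, hR10, hR1z⟩ := conjPow_series_leading 0 9 3 (by norm_num) (by norm_num)
    (by norm_num)
  obtain ⟨R2, hR2, hR20, hR2z⟩ := conjPow_series_leading 1 9 2 (by norm_num) (by norm_num)
    (by norm_num)
  obtain ⟨R3, hR3, hR30, hR3z⟩ := conjPow_series_leading 2 9 1 (by norm_num) (by norm_num)
    (by norm_num)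
  obtain ⟨R4, hR4, hR40, hR4z⟩ := conjPow_series_leading 0 11 1 (by norm_num) (by norm_num)
    (by norm_num)
  obtain ⟨R5, hR5, hR50, hR5z⟩ := conjPow_series_leading 0 7 1 (by norm_num) (by norm_num)
    (by norm_num)
  obtain ⟨R6, hR6, hR60, hR6z⟩ := conjPow_series_leading 0 3 1 (by norm_num) (by norm_num)
    (by norm_num)
  norm_num [Nat.ascFactorial, Nat.factorial] at hR10 hR20 hR30 hR40 hR50 hR60
  have key := eq_zero_of_elliptic
    (f := fun z => mix 9 2 z - eis 11 z + 2 * G₄ * eis 7 z - (G₄ ^ 2 - 2 * G₈) * eis 3 z)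
    (Q := fun z => (2 * G₄ * G₈ - 2 * G₁₂ + z ^ 4 * U z) + (1 + z ^ 4 * t z) ^ 2 * R1 z
      + 2 * π * (1 + z ^ 4 * t z) * R2 z + π ^ 2 * R3 z - R4 z + 2 * G₄ * R5 z
      - (G₄ ^ 2 - 2 * G₈) * R6 z)
    ?_ ?_ (by fun_prop) ?_
  · have h := key.2
    simp only [hR10, hR20, hR30, hR40, hR50, hR60] at h
    linear_combination h
  · intro z hz
    have := differentiableAt_mix (k := 9) (j := 2) (by norm_num) hz
    have := (hasDerivAt_eis (k := 11) (by norm_num) hz).differentiableAt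
    have := (hasDerivAt_eis (k := 7) (by norm_num) hz).differentiableAt
    have := (hasDerivAt_eis (k := 3) (by norm_num) hz).differentiableAt
    fun_prop
  · intro z hz l
    simp only [mix_add_coe _ _ hz, eis_add_coe]
  · intro z hzL
    have h0 := ne_zero_of_notMem hzL
    obtain ⟨e1, e2, e3, e4⟩ := hz z h0
    simp only [mix_eq (k := 9) (j := 2) (by norm_num) hzL,
      eis_eq (k := 11) (by norm_num) hzL,
      eis_eq (k := 7) (by norm_num) hzL,
      eis_eq (k := 3) (by norm_num) hzL,
      Finset.sum_range_succ, Finset.sum_range_zero, hR1z, hR2z, hR3z, hR4z, hR5z, hR6z, e1,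
      Nat.choose]
    norm_num
    field_simp
    linear_combination e3

lemma mix_nine_one : ∀ z ∉ Λ, mix 9 1 z =
    eis 10 z - G₄ * eis 6 z - G₈ * periods.weierstrassP z := by
  obtain ⟨t, v, U, V, ⟨ht, hv, hU, hV⟩, hz⟩ := zeta_jet
  obtain ⟨P, hP, hPz⟩ := weierstrassP_taylor
  obtain ⟨R1, hR1, hR10, hR1z⟩ := conjPow_series_leading 0 9 3 (by norm_num) (by norm_num)
    (by norm_num)
  obtain ⟨R2, hR2, hR20, hR2z⟩ := conjPow_series_leading 1 9 2 (by norm_num) (by norm_num)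
    (by norm_num)
  obtain ⟨R3, hR3, hR30, hR3z⟩ := conjPow_series_leading 0 10 2 (by norm_num) (by norm_num)
    (by norm_num)
  obtain ⟨R4, hR4, hR40, hR4z⟩ := conjPow_series_leading 0 6 2 (by norm_num) (by norm_num)
    (by norm_num)
  norm_num [Nat.ascFactorial, Nat.factorial] at hR10 hR20 hR30 hR40
  have key := eq_zero_of_elliptic
    (f := fun z => mix 9 1 z - eis 10 z + G₄ * eis 6 z + G₈ * periods.weierstrassP z)
    (Q := fun z => z * ((-G₁₂ + z ^ 4 * v z) + (1 + z ^ 4 * t z) * R1 z + π * R2 z - R3 z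
      + G₄ * R4 z + G₈ * (3 * G₄ + 7 * G₈ * z ^ 4 + 11 * G₁₂ * z ^ 8 + z ^ 12 * P z)))
    ?_ ?_ (by fun_prop) ?_
  · intro z hz
    linear_combination key.1 z hz
  · intro z hz
    have := differentiableAt_mix (k := 9) (j := 1) (by norm_num) hz
    have := (hasDerivAt_eis (k := 10) (by norm_num) hz).differentiableAt
    have := (hasDerivAt_eis (k := 6) (by norm_num) hz).differentiableAt
    have := differentiableAt_weierstrassP hz
    fun_prop
  · intro z hz l
    simp only [mix_add_coe _ _ hz, eis_add_coe, periods.weierstrassP_add_coe]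
  · intro z hzL
    have h0 := ne_zero_of_notMem hzL
    obtain ⟨e1, e2, e3, e4⟩ := hz z h0
    have hP' := hPz z hzL
    rw [mul_comm, ← eq_div_iff (pow_ne_zero 2 h0)] at hP'
    simp only [mix_eq (k := 9) (j := 1) (by norm_num) hzL,
      eis_eq (k := 10) (by norm_num) hzL,
      eis_eq (k := 6) (by norm_num) hzL,
      Finset.sum_range_succ, Finset.sum_range_zero, hR1z, hR2z, hR3z, hR4z, hP', e1,
      Nat.choose]
    norm_num
    field_simp
    linear_combination e2

lemma mix_eight_two : ∀ z ∉ Λ, mix 8 2 z =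
    eis 10 z - 2 * G₄ * eis 6 z + (G₄ ^ 2 - G₈) * periods.weierstrassP z := by
  obtain ⟨t, v, U, V, ⟨ht, hv, hU, hV⟩, hz⟩ := zeta_jet
  obtain ⟨P, hP, hPz⟩ := weierstrassP_taylor
  obtain ⟨R1, hR1, hR1z⟩ := conjPow_series_taylor 0 8 0 (by norm_num) (by norm_num)
    (by norm_num)
  obtain ⟨R2, hR2, hR20, hR2z⟩ := conjPow_series_leading 1 8 3 (by norm_num) (by norm_num)
    (by norm_num)
  obtain ⟨R3, hR3, hR30, hR3z⟩ := conjPow_series_leading 2 8 2 (by norm_num) (by norm_num)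
    (by norm_num)
  obtain ⟨R4, hR4, hR40, hR4z⟩ := conjPow_series_leading 0 10 2 (by norm_num) (by norm_num)
    (by norm_num)
  obtain ⟨R5, hR5, hR50, hR5z⟩ := conjPow_series_leading 0 6 2 (by norm_num) (by norm_num)
    (by norm_num)
  norm_num [Nat.ascFactorial, Nat.factorial] at hR20 hR30 hR40 hR50 hR1z
  have key := eq_zero_of_elliptic
    (f := fun z => mix 8 2 z - eis 10 z + 2 * G₄ * eis 6 z - (G₄ ^ 2 - G₈) * periods.weierstrassP z)
    (Q := fun z => z * ((2 * G₄ * G₈ - 2 * G₁₂ + z ^ 4 * U z) + G₈ * t z * (2 + z ^ 4 * t z)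
      + (1 + z ^ 4 * t z) ^ 2 * R1 z + 2 * π * (1 + z ^ 4 * t z) * R2 z + π ^ 2 * R3 z - R4 z
      + 2 * G₄ * R5 z
      - (G₄ ^ 2 - G₈) * (3 * G₄ + 7 * G₈ * z ^ 4 + 11 * G₁₂ * z ^ 8 + z ^ 12 * P z)))
    ?_ ?_ (by fun_prop) ?_
  · intro z hz
    linear_combination key.1 z hz
  · intro z hz
    have := differentiableAt_mix (k := 8) (j := 2) (by norm_num) hz
    have := (hasDerivAt_eis (k := 10) (by norm_num) hz).differentiableAt
    have := (hasDerivAt_eis (k := 6) (by norm_num) hz).differentiableAt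
    have := differentiableAt_weierstrassP hz
    fun_prop
  · intro z hz l
    simp only [mix_add_coe _ _ hz, eis_add_coe, periods.weierstrassP_add_coe]
  · intro z hzL
    have h0 := ne_zero_of_notMem hzL
    obtain ⟨e1, e2, e3, e4⟩ := hz z h0
    have hP' := hPz z hzL
    rw [mul_comm, ← eq_div_iff (pow_ne_zero 2 h0)] at hP'
    simp only [mix_eq (k := 8) (j := 2) (by norm_num) hzL,
      eis_eq (k := 10) (by norm_num) hzL,
      eis_eq (k := 6) (by norm_num) hzL,
      Finset.sum_range_succ, Finset.sum_range_zero, hR1z, hR2z, hR3z, hR4z, hR5z, hP', e1,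
      Nat.choose]
    norm_num
    field_simp
    linear_combination e3

lemma mix_ten_four : ∀ z ∉ Λ, mix 10 4 z =
    eis 14 z - 4 * G₄ * eis 10 z + (6 * G₄ ^ 2 - 4 * G₈) * eis 6 z +
    (12 * G₄ * G₈ - 4 * G₄ ^ 3 - 4 * G₁₂ + 55 * G₁₂ - 40 * π * A₁
      + 6 * π ^ 2 * A₂) * periods.weierstrassP z := by
  obtain ⟨t, v, U, V, ⟨ht, hv, hU, hV⟩, hz⟩ := zeta_jet
  obtain ⟨P, hP, hPz⟩ := weierstrassP_taylor
  obtain ⟨R1, hR1, hR1z⟩ := conjPow_series_taylor 0 10 2 (by norm_num) (by norm_num)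
    (by norm_num)
  obtain ⟨R2, hR2, hR2z⟩ := conjPow_series_taylor 1 10 1 (by norm_num) (by norm_num)
    (by norm_num)
  obtain ⟨R3, hR3, hR3z⟩ := conjPow_series_taylor 2 10 0 (by norm_num) (by norm_num)
    (by norm_num)
  obtain ⟨R4, hR4, hR40, hR4z⟩ := conjPow_series_leading 3 10 3 (by norm_num) (by norm_num)
    (by norm_num)
  obtain ⟨R5, hR5, hR50, hR5z⟩ := conjPow_series_leading 4 10 2 (by norm_num) (by norm_num)
    (by norm_num)
  obtain ⟨R6, hR6, hR60, hR6z⟩ := conjPow_series_leading 0 14 2 (by norm_num) (by norm_num)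
    (by norm_num)
  obtain ⟨R7, hR7, hR70, hR7z⟩ := conjPow_series_leading 0 6 2 (by norm_num) (by norm_num)
    (by norm_num)
  norm_num [Nat.ascFactorial, Nat.factorial] at hR40 hR50 hR60 hR70 hR1z hR2z hR3z
  have key := eq_zero_of_elliptic
    (f := fun z => mix 10 4 z - eis 14 z + 4 * G₄ * eis 10 z - (6 * G₄ ^ 2 - 4 * G₈) * eis 6 z -
      (12 * G₄ * G₈ - 4 * G₄ ^ 3 - 4 * G₁₂ + 55 * G₁₂ - 40 * π * A₁
      + 6 * π ^ 2 * A₂) * periods.weierstrassP z)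
    (Q := fun z => z * (V z + 55 * G₁₂ * t z * ((1 + z ^ 4 * t z) ^ 3 + (1 + z ^ 4 * t z) ^ 2
      + (1 + z ^ 4 * t z) + 1) + (1 + z ^ 4 * t z) ^ 4 * R1 z
      + 4 * π * (-10 * A₁ * t z * ((1 + z ^ 4 * t z) ^ 2 + (1 + z ^ 4 * t z) + 1)
      + (1 + z ^ 4 * t z) ^ 3 * R2 z)
      + 6 * π ^ 2 * (A₂ * t z * (2 + z ^ 4 * t z) + (1 + z ^ 4 * t z) ^ 2 * R3 z)
      + 4 * π ^ 3 * (1 + z ^ 4 * t z) * R4 z + π ^ 4 * R5 z - R6 z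
      + 4 * G₄ * (55 * G₁₂ + z ^ 4 * R1 z) - (6 * G₄ ^ 2 - 4 * G₈) * R7 z
      - (12 * G₄ * G₈ - 4 * G₄ ^ 3 - 4 * G₁₂ + 55 * G₁₂ - 40 * π * A₁
      + 6 * π ^ 2 * A₂) * (3 * G₄ + 7 * G₈ * z ^ 4 + 11 * G₁₂ * z ^ 8 + z ^ 12 * P z)))
    ?_ ?_ (by fun_prop) ?_
  · intro z hz
    linear_combination key.1 z hz
  · intro z hz
    have := differentiableAt_mix (k := 10) (j := 4) (by norm_num) hz
    have := (hasDerivAt_eis (k := 14) (by norm_num) hz).differentiableAt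
    have := (hasDerivAt_eis (k := 10) (by norm_num) hz).differentiableAt
    have := (hasDerivAt_eis (k := 6) (by norm_num) hz).differentiableAt
    have := differentiableAt_weierstrassP hz
    fun_prop
  · intro z hz l
    simp only [mix_add_coe _ _ hz, eis_add_coe, periods.weierstrassP_add_coe]
  · intro z hzL
    have h0 := ne_zero_of_notMem hzL
    obtain ⟨e1, e2, e3, e4⟩ := hz z h0
    have hP' := hPz z hzL
    rw [mul_comm, ← eq_div_iff (pow_ne_zero 2 h0)] at hP'
    simp only [mix_eq (k := 10) (j := 4) (by norm_num) hzL,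
      eis_eq (k := 14) (by norm_num) hzL,
      eis_eq (k := 10) (by norm_num) hzL,
      eis_eq (k := 6) (by norm_num) hzL,
      Finset.sum_range_succ, Finset.sum_range_zero, hR1z, hR2z, hR3z, hR4z, hR5z, hR6z, hR7z, hP', e1,
      Nat.choose]
    norm_num
    field_simp
    linear_combination e4

lemma eventually_notMem (s : ℂ) : ∀ᶠ z in 𝓝[≠] s, z ∉ Λ :=
  (eventually_two_mul_notMem s).mono fun z hz hmem => by
    rw [two_mul] at hz
    exact hz (add_mem hmem hmem)

lemma eq_zero_of_pow_mul_eq_zero {Q : ℂ → ℂ} (hQ : ContinuousAt Q 0) (n : ℕ)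
    (h : ∀ z ∉ Λ, z ^ n * Q z = 0) : Q 0 = 0 := by
  have h1 : Tendsto Q (𝓝[≠] 0) (𝓝 (Q 0)) := hQ.tendsto.mono_left nhdsWithin_le_nhds
  refine tendsto_nhds_unique h1 (tendsto_const_nhds.congr' ?_)
  filter_upwards [eventually_notMem 0] with z hz
  exact ((mul_eq_zero.1 (h z hz)).resolve_left (pow_ne_zero _ (ne_zero_of_notMem hz))).symm

lemma eis_four_taylor : ∃ R : ℂ → ℂ, ContinuousAt R 0 ∧ ∀ z, series (conjPow 0) 4 z =
    G₄ + 35 * G₈ * z ^ 4 + 165 * G₁₂ * z ^ 8 + z ^ 12 * R z := by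
  obtain ⟨R, hR, hT⟩ := series_taylor (admissible_conjPow (j := 0) (k := 4) (by norm_num))
    (conjPow_zero 0) 12
  refine ⟨R, hR, fun z => ?_⟩
  have hW : ∀ i, series (conjPow 0) i 0 = latticeSum i 0 := fun i => rfl
  rw [hT z]
  simp only [Finset.sum_range_succ, Finset.sum_range_zero, hW, Nat.ascFactorial, Nat.factorial]
  norm_num
  rw [latticeSum_eq_zero (s := 5) (by norm_num),
    latticeSum_eq_zero (s := 6) (by norm_num), latticeSum_eq_zero (s := 7) (by norm_num),
    latticeSum_eq_zero (s := 9) (by norm_num), latticeSum_eq_zero (s := 10) (by norm_num),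
    latticeSum_eq_zero (s := 11) (by norm_num), latticeSum_eq_zero (s := 13) (by norm_num),
    latticeSum_eq_zero (s := 14) (by norm_num), latticeSum_eq_zero (s := 15) (by norm_num)]
  ring

lemma eis_four_aux : (∀ z ∉ Λ, eis 4 z = periods.weierstrassP z ^ 2 - 5 * G₄) ∧
    21 * G₈ - 9 * G₄ ^ 2 = 0 ∧ 143 * G₁₂ - 42 * G₄ * G₈ = 0 := by
  obtain ⟨P, hP, hPz⟩ := weierstrassP_taylor
  obtain ⟨R, hR, hRz⟩ := eis_four_taylor
  have hexp : ∀ z ∉ Λ, eis 4 z - periods.weierstrassP z ^ 2 + 5 * G₄ =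
      z ^ 4 * ((21 * G₈ - 9 * G₄ ^ 2) + z ^ 4 * ((143 * G₁₂ - 42 * G₄ * G₈) + z ^ 4 *
      (R z - (49 * G₈ ^ 2 + 66 * G₄ * G₁₂ + 2 * P z + z ^ 4 * (154 * G₈ * G₁₂ + 6 * G₄ * P z)
        + z ^ 8 * (121 * G₁₂ ^ 2 + 14 * G₈ * P z) + 22 * z ^ 12 * G₁₂ * P z
        + z ^ 16 * P z ^ 2)))) := by
    intro z hzL
    have h0 := ne_zero_of_notMem hzL
    have hP' := hPz z hzL
    rw [mul_comm, ← eq_div_iff (pow_ne_zero 2 h0)] at hP'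
    rw [eis_eq (by norm_num) hzL, hRz, hP']
    field_simp
    ring
  have key := eq_zero_of_elliptic (f := fun z => eis 4 z - periods.weierstrassP z ^ 2 + 5 * G₄)
    (Q := fun z => z ^ 3 * ((21 * G₈ - 9 * G₄ ^ 2) + z ^ 4 * ((143 * G₁₂ - 42 * G₄ * G₈) + z ^ 4 *
      (R z - (49 * G₈ ^ 2 + 66 * G₄ * G₁₂ + 2 * P z + z ^ 4 * (154 * G₈ * G₁₂ + 6 * G₄ * P z)
        + z ^ 8 * (121 * G₁₂ ^ 2 + 14 * G₈ * P z) + 22 * z ^ 12 * G₁₂ * P z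
        + z ^ 16 * P z ^ 2)))))
    ?_ ?_ (by fun_prop) ?_
  · have h1 : 21 * G₈ - 9 * G₄ ^ 2 = 0 := by
      have := eq_zero_of_pow_mul_eq_zero (by fun_prop) 4
        fun z hz => (hexp z hz).symm.trans (key.1 z hz)
      simpa using this
    refine ⟨fun z hz => by linear_combination key.1 z hz, h1, ?_⟩
    have := eq_zero_of_pow_mul_eq_zero
      (Q := fun z => (143 * G₁₂ - 42 * G₄ * G₈) + z ^ 4 *
      (R z - (49 * G₈ ^ 2 + 66 * G₄ * G₁₂ + 2 * P z + z ^ 4 * (154 * G₈ * G₁₂ + 6 * G₄ * P z)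
        + z ^ 8 * (121 * G₁₂ ^ 2 + 14 * G₈ * P z) + 22 * z ^ 12 * G₁₂ * P z
        + z ^ 16 * P z ^ 2))) (by fun_prop) 8 fun z hz => by
        have := (hexp z hz).symm.trans (key.1 z hz)
        rw [h1] at this
        linear_combination this
    simpa using this
  · intro z hz
    have := (hasDerivAt_eis (k := 4) (by norm_num) hz).differentiableAt
    have := differentiableAt_weierstrassP hz
    fun_prop
  · intro z hz l
    simp only [eis_add_coe, periods.weierstrassP_add_coe]
  · intro z hz
    rw [hexp z hz]
    ring

lemma eis_four {z : ℂ} (hz : z ∉ Λ) : eis 4 z = periods.weierstrassP z ^ 2 - 5 * G₄ :=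
  eis_four_aux.1 z hz

lemma latticeSum_eight : G₈ = 3 / 7 * G₄ ^ 2 := by
  linear_combination (1 / 21 : ℂ) * eis_four_aux.2.1

lemma latticeSum_twelve : G₁₂ = 18 / 143 * G₄ ^ 3 := by
  have h := eis_four_aux.2.2
  rw [latticeSum_eight] at h
  linear_combination (1 / 143 : ℂ) * h

lemma derivWeierstrassP_eq {z : ℂ} : periods.derivWeierstrassP z = -2 * eis 3 z := by
  have h := periods.hasSum_derivWeierstrassP z
  rw [← (Equiv.neg Λ).hasSum_iff] at h
  rw [eis, series, ← tsum_mul_left, ← h.tsum_eq]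
  refine tsum_congr fun l => ?_
  simp only [Function.comp_apply, Equiv.neg_apply, NegMemClass.coe_neg, sub_neg_eq_add]
  ring

lemma hasDerivAt_weierstrassP {z : ℂ} (hz : z ∉ Λ) :
    HasDerivAt periods.weierstrassP (-2 * eis 3 z) z := by
  rw [← derivWeierstrassP_eq, ← periods.deriv_weierstrassP]
  exact (differentiableAt_weierstrassP hz).hasDerivAt

lemma G_eq (n : ℕ) (hn : n ≠ 0) : periods.G n = latticeSum n 0 := by
  refine tsum_congr fun l => ?_
  by_cases hl : l = 0
  · simp [hl, conjPow, hn]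
  · simp [hl, conjPow]

lemma eis_three_sq {z : ℂ} (hz : z ∉ Λ) :
    eis 3 z ^ 2 = periods.weierstrassP z ^ 3 - 15 * G₄ * periods.weierstrassP z := by
  have h := periods.derivWeierstrassP_sq z hz
  rw [derivWeierstrassP_eq, PeriodPair.g₂, PeriodPair.g₃, G_eq 4 (by norm_num),
    G_eq 6 (by norm_num), latticeSum_eq_zero (s := 6) (by norm_num)] at h
  linear_combination (1 / 4 : ℂ) * h

open Polynomial in
lemma eis_add_two {k : ℕ} (hk : 3 ≤ k) (p : ℂ[X])
    (hp : ∀ z ∉ Λ, eis k z = p.eval (periods.weierstrassP z)) {z : ℂ} (hz : z ∉ Λ) :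
    k * (k + 1) * eis (k + 2) z =
      4 * p.derivative.derivative.eval (periods.weierstrassP z) *
        (periods.weierstrassP z ^ 3 - 15 * G₄ * periods.weierstrassP z)
      + 6 * p.derivative.eval (periods.weierstrassP z) *
        (periods.weierstrassP z ^ 2 - 5 * G₄) := by
  have h1 : ∀ z ∉ Λ, k * eis (k + 1) z =
      2 * p.derivative.eval (periods.weierstrassP z) * eis 3 z := fun z hz => by
    have h2 := (p.hasDerivAt _).comp z (hasDerivAt_weierstrassP hz)
    have h3 : HasDerivAt (eis k) _ z := h2.congr_of_eventuallyEq (by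
      filter_upwards [isOpen_compl.mem_nhds hz] with w hw using hp w hw)
    linear_combination -(hasDerivAt_eis hk hz).unique h3
  have h2 := (((p.derivative.hasDerivAt _).comp z (hasDerivAt_weierstrassP hz)).const_mul 2).mul
    (hasDerivAt_eis (k := 3) le_rfl hz)
  have h3 : HasDerivAt (fun z => k * eis (k + 1) z) _ z := h2.congr_of_eventuallyEq (by
      filter_upwards [isOpen_compl.mem_nhds hz] with w hw using h1 w hw)
  have h4 := ((hasDerivAt_eis (k := k + 1) (by omega) hz).const_mul (k : ℂ)).unique h3
  simp only [Function.comp_apply] at h4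
  rw [← eis_three_sq hz, ← eis_four hz]
  push_cast at h4
  linear_combination -h4

open Polynomial in
lemma eis_six {z : ℂ} (hz : z ∉ Λ) : eis 6 z =
    periods.weierstrassP z ^ 3 - 9 * G₄ * periods.weierstrassP z := by
  have h := eis_add_two (k := 4) (by norm_num) (X ^ 2 - C (5 * G₄))
    (fun z hz => by rw [eis_four hz]; simp) hz
  simp [-map_pow] at h
  linear_combination (1 / 20 : ℂ) * h

open Polynomial in
lemma eis_eight {z : ℂ} (hz : z ∉ Λ) : eis 8 z =
    periods.weierstrassP z ^ 4 - 12 * G₄ * periods.weierstrassP z ^ 2 + 45 / 7 * G₄ ^ 2 := by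
  have h := eis_add_two (k := 6) (by norm_num) (X ^ 3 - C (9 * G₄) * X)
    (fun z hz => by rw [eis_six hz]; simp) hz
  simp [-map_pow] at h
  linear_combination (1 / 42 : ℂ) * h

open Polynomial in
lemma eis_ten {z : ℂ} (hz : z ∉ Λ) : eis 10 z =
    periods.weierstrassP z ^ 5 - 15 * G₄ * periods.weierstrassP z ^ 3
      + 30 * G₄ ^ 2 * periods.weierstrassP z := by
  have h := eis_add_two (k := 8) (by norm_num) (X ^ 4 - C (12 * G₄) * X ^ 2 + C (45 / 7 * G₄ ^ 2))
    (fun z hz => by rw [eis_eight hz]; simp) hz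
  simp [-map_pow] at h
  linear_combination (1 / 72 : ℂ) * h

open Polynomial in
lemma eis_twelve {z : ℂ} (hz : z ∉ Λ) : eis 12 z =
    periods.weierstrassP z ^ 6 - 18 * G₄ * periods.weierstrassP z ^ 4
      + 63 * G₄ ^ 2 * periods.weierstrassP z ^ 2 - 90 / 11 * G₄ ^ 3 := by
  have h := eis_add_two (k := 10) (by norm_num) (X ^ 5 - C (15 * G₄) * X ^ 3 + C (30 * G₄ ^ 2) * X)
    (fun z hz => by rw [eis_ten hz]; simp) hz
  simp [-map_pow] at h
  linear_combination (1 / 110 : ℂ) * h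

open Polynomial in
lemma eis_fourteen {z : ℂ} (hz : z ∉ Λ) : eis 14 z =
    periods.weierstrassP z ^ 7 - 21 * G₄ * periods.weierstrassP z ^ 5
      + 105 * G₄ ^ 2 * periods.weierstrassP z ^ 3 - 945 / 13 * G₄ ^ 3 * periods.weierstrassP z := by
  have h := eis_add_two (k := 12) (by norm_num) (X ^ 6 - C (18 * G₄) * X ^ 4 + C (63 * G₄ ^ 2) * X ^ 2
    - C (90 / 11 * G₄ ^ 3))
    (fun z hz => by rw [eis_twelve hz]; simp) hz
  simp [-map_pow] at h
  linear_combination (1 / 156 : ℂ) * h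

lemma weierstrassP_I_mul (z : ℂ) :
    periods.weierstrassP (Complex.I * z) = -periods.weierstrassP z := by
  have h := periods.hasSum_weierstrassP (Complex.I * z)
  rw [← mulI.hasSum_iff] at h
  refine h.unique (((periods.hasSum_weierstrassP z).neg).congr_fun fun l => ?_)
  simp only [Function.comp_apply, coe_mulI, ← mul_sub, mul_pow, Complex.I_sq, neg_one_mul, div_neg]
  ring

lemma weierstrassP_conj (z : ℂ) :
    periods.weierstrassP ((starRingEnd ℂ) z) = (starRingEnd ℂ) (periods.weierstrassP z) := by
  have h := periods.hasSum_weierstrassP ((starRingEnd ℂ) z)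
  rw [← conjEquiv.hasSum_iff] at h
  have h2 := Complex.hasSum_conj'.2 (periods.hasSum_weierstrassP z)
  refine h.unique (h2.congr_fun fun l => ?_)
  simp [conjEquiv]

lemma weierstrassP_add_one (z : ℂ) : periods.weierstrassP (z + 1) = periods.weierstrassP z :=
  periods.weierstrassP_add_coe z ⟨1, one_mem⟩

/-- The value of the Weierstrass function at the half period `1 / 2`. -/
noncomputable def halfValue : ℂ := periods.weierstrassP (1 / 2)

lemma eis_three_half : eis 3 (1 / 2) = 0 := by
  have h1 := periods.derivWeierstrassP_neg (-(1 / 2))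
  have h2 := periods.derivWeierstrassP_add_coe (-(1 / 2)) ⟨1, one_mem⟩
  rw [show (-(1 / 2) : ℂ) + ((⟨1, one_mem⟩ : Λ) : ℂ) = 1 / 2 by norm_num] at h2
  rw [neg_neg, ← h2, derivWeierstrassP_eq] at h1
  linear_combination (-1 / 4 : ℂ) * h1

lemma halfValue_cubed : halfValue ^ 3 = 15 * G₄ * halfValue := by
  have h := eis_three_sq half_notMem
  rw [eis_three_half] at h
  rw [halfValue]
  linear_combination -h

lemma weierstrassP_product_half :
    (periods.weierstrassP (Complex.I / 2) - halfValue) *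
      (periods.weierstrassP (Complex.I / 2 + 1 / 2) - halfValue) = 2 * halfValue ^ 2 := by
  have h1 : periods.weierstrassP (Complex.I / 2) = -halfValue := by
    rw [halfValue, ← weierstrassP_I_mul]
    ring_nf
  have h2 := weierstrassP_I_mul (Complex.I / 2 + 1 / 2)
  rw [← weierstrassP_add_one, show Complex.I * (Complex.I / 2 + 1 / 2) + 1 =
    Complex.I / 2 + 1 / 2 by linear_combination (1 / 2 : ℂ) * Complex.I_mul_I] at h2
  rw [h1]
  linear_combination (-halfValue) * h2

lemma tendsto_sq_mul_weierstrassP :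
    Tendsto (fun z => z ^ 2 * periods.weierstrassP z) (𝓝[≠] 0) (𝓝 1) := by
  obtain ⟨R, hR, h⟩ := weierstrassP_taylor
  have hc : ContinuousAt (fun z => 1 + 3 * latticeSum 4 0 * z ^ 4 + 7 * latticeSum 8 0 * z ^ 8
      + 11 * latticeSum 12 0 * z ^ 12 + z ^ 16 * R z) 0 := by fun_prop
  have h1 := hc.tendsto.mono_left (nhdsWithin_le_nhds (s := {0}ᶜ))
  simp only [ne_eq, OfNat.ofNat_ne_zero, not_false_eq_true, zero_pow, mul_zero, add_zero,
    zero_mul] at h1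
  refine h1.congr' ?_
  filter_upwards [eventually_notMem 0] with z hz using (h z hz).symm

lemma exists_weierstrassP_add_half : ∃ R : ℂ → ℂ, ContinuousAt R 0 ∧
    ∀ z, periods.weierstrassP (z + 1 / 2) - halfValue = z ^ 2 * R z := by
  have ha : AnalyticAt ℂ (fun z => periods.weierstrassP (z + 1 / 2)) 0 := by
    have h1 : AnalyticAt ℂ periods.weierstrassP (0 + 1 / 2) := by
      rw [zero_add]
      exact periods.analyticOnNhd_weierstrassP _ half_notMem
    exact h1.comp_of_eq (f := fun z => z + 1 / 2) (by fun_prop) rfl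
  obtain ⟨R, hR, h⟩ := ha.exists_eq_sum_add_pow_mul 2
  refine ⟨R, hR.continuousAt, fun z => ?_⟩
  have hd : deriv (fun z => periods.weierstrassP (z + 1 / 2)) 0 = 0 := by
    rw [deriv_comp_add_const, zero_add, periods.deriv_weierstrassP, derivWeierstrassP_eq,
      eis_three_half, mul_zero]
  rw [h z]
  simp only [Finset.sum_range_succ, Finset.sum_range_zero, iteratedDeriv_zero, iteratedDeriv_one, hd,
    halfValue, zero_add, smul_eq_mul, Nat.factorial, Nat.cast_one, pow_zero]
  ring

lemma weierstrassP_product {z : ℂ} (hz : z ∉ Λ) (hz' : z + 1 / 2 ∉ Λ) :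
    (periods.weierstrassP z - halfValue) * (periods.weierstrassP (z + 1 / 2) - halfValue) =
      2 * halfValue ^ 2 := by
  set f : ℂ → ℂ := fun z =>
    (periods.weierstrassP z - halfValue) * (periods.weierstrassP (z + 1 / 2) - halfValue) with hf
  have hper : ∀ z, ∀ l : Λ, f (z + l) = f z := fun z l => by
    simp only [hf, periods.weierstrassP_add_coe, add_right_comm z (l : ℂ)]
  have hhalf : ∀ z, f (z + 1 / 2) = f z := fun z => by
    simp only [hf]
    rw [show z + 1 / 2 + 1 / 2 = z + 1 by ring, weierstrassP_add_one, mul_comm]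
  set S : Set ℂ := {z | z ∈ Λ ∨ z + 1 / 2 ∈ Λ} with hS
  have hshift : ∀ s ∈ S, ∀ z, f (z - s) = f z := by
    rintro s (hs | hs) z
    · have h1 := hper z (-⟨s, hs⟩)
      rwa [NegMemClass.coe_neg, ← sub_eq_add_neg] at h1
    · have h1 := hper (z + 1 / 2) (-⟨s + 1 / 2, hs⟩)
      rw [← hhalf z, ← h1]
      congr 1
      simp only [NegMemClass.coe_neg]
      ring
  obtain ⟨R, hR, hT⟩ := exists_weierstrassP_add_half
  have hlim0 : Tendsto f (𝓝[≠] 0) (𝓝 (R 0)) := by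
    have h1 : Tendsto (fun z : ℂ => z ^ 2 * halfValue) (𝓝[≠] 0) (𝓝 0) := by
      have : ContinuousAt (fun z : ℂ => z ^ 2 * halfValue) 0 := by fun_prop
      simpa using this.tendsto.mono_left (nhdsWithin_le_nhds (s := {0}ᶜ))
    have h2 := (tendsto_sq_mul_weierstrassP.sub h1).mul
      (hR.tendsto.mono_left (nhdsWithin_le_nhds (s := {0}ᶜ)))
    rw [sub_zero, one_mul] at h2
    refine h2.congr fun z => ?_
    simp only [hf]
    rw [hT]
    ring
  have hlim : ∀ s ∈ S, Tendsto f (𝓝[≠] s) (𝓝 (R 0)) := fun s hs => by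
    have h1 : Tendsto (fun z => z - s) (𝓝[≠] s) (𝓝[≠] 0) := by
      refine tendsto_nhdsWithin_iff.2 ⟨?_, ?_⟩
      · have : ContinuousAt (fun z => z - s) s := by fun_prop
        simpa using this.tendsto.mono_left (nhdsWithin_le_nhds (s := {s}ᶜ))
      · filter_upwards [self_mem_nhdsWithin] with z hz using sub_ne_zero.2 hz
    exact (hlim0.comp h1).congr (hshift s hs)
  have key : ∀ z ∉ S, f z = R 0 := fun z hz => by
    refine eq_of_periodic (S := S) ?_ (Or.inl (zero_mem _)) ?_ ?_ (fun z _ => hper z) hlim hz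
    · rintro z (hz | hz)
      · rw [two_mul]
        exact add_mem hz hz
      · rw [show 2 * z = (z + 1 / 2) + (z + 1 / 2) - 1 by ring]
        exact sub_mem (add_mem hz hz) one_mem
    · intro z l
      simp only [hS, Set.mem_ofPred_eq, add_mem_iff, add_right_comm z (l : ℂ)]
    · intro z hz
      obtain ⟨h1, h2⟩ := not_or.1 hz
      have h3 := differentiableAt_weierstrassP h1
      have h4 : DifferentiableAt ℂ (fun z => periods.weierstrassP (z + 1 / 2)) z :=
        by
        exact DifferentiableAt.comp z (f := fun z => z + 1 / 2) (differentiableAt_weierstrassP h2)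
          (by fun_prop)
      simp only [hf]
      fun_prop
  have h1 : Complex.I / 2 ∉ S :=
    not_or.2 ⟨notMem_of_im (by norm_num), notMem_of_im (by norm_num)⟩
  exact (key z (not_or.2 ⟨hz, hz'⟩)).trans ((key _ h1).symm.trans weierstrassP_product_half)

lemma halfValue_ne_zero : halfValue ≠ 0 := by
  intro h0
  have hprod : ∀ᶠ z in 𝓝[≠] (0 : ℂ), periods.weierstrassP (z + 1 / 2) = 0 := by
    have h1 : ∀ᶠ z in 𝓝[≠] (0 : ℂ), z ^ 2 * periods.weierstrassP z ≠ 0 :=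
      tendsto_sq_mul_weierstrassP.eventually_ne one_ne_zero
    filter_upwards [eventually_two_mul_notMem 0, h1] with z hz hz1
    have h := weierstrassP_product (z := z) (fun h => hz (by rw [two_mul]; exact add_mem h h))
      (fun h => hz (by
        rw [show 2 * z = (z + 1 / 2) + (z + 1 / 2) - 1 by ring]
        exact sub_mem (add_mem h h) one_mem))
    rw [h0] at h
    simpa [right_ne_zero_of_mul hz1] using h
  have hfreq : ∃ᶠ z in 𝓝[≠] (1 / 2 : ℂ), periods.weierstrassP z = 0 := by
    have h2 : Tendsto (fun z => z + 1 / 2) (𝓝[≠] (0 : ℂ)) (𝓝[≠] (1 / 2)) := by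
      refine tendsto_nhdsWithin_iff.2 ⟨?_, ?_⟩
      · have : ContinuousAt (fun z : ℂ => z + 1 / 2) 0 := by fun_prop
        simpa using this.tendsto.mono_left (nhdsWithin_le_nhds (s := {0}ᶜ))
      · filter_upwards [self_mem_nhdsWithin] with z hz
        simpa using hz
    exact h2.frequently hprod.frequently
  have hzero := periods.analyticOnNhd_weierstrassP.eqOn_zero_of_preconnected_of_frequently_eq_zero
    isPreconnected_compl half_notMem hfreq
  have h3 : Tendsto (fun z => z ^ 2 * periods.weierstrassP z) (𝓝[≠] 0) (𝓝 0) := by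
    refine tendsto_const_nhds.congr' ?_
    filter_upwards [eventually_notMem 0] with z hz
    rw [hzero hz]
    simp
  exact zero_ne_one (tendsto_nhds_unique h3 tendsto_sq_mul_weierstrassP)

lemma halfValue_sq : halfValue ^ 2 = 15 * G₄ :=
  mul_right_cancel₀ halfValue_ne_zero (by linear_combination halfValue_cubed)

lemma ofReal_notMem {x : ℝ} (h0 : 0 < x) (h1 : x < 1) : (x : ℂ) ∉ Λ := fun h => by
  obtain ⟨m, n, h⟩ := mem_iff.1 h
  have h2 := congrArg Complex.re h
  simp only [Complex.add_re, Complex.intCast_re, Complex.mul_re, Complex.I_re, mul_zero,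
    Complex.intCast_im, Complex.I_im, mul_one, sub_self, add_zero, Complex.ofReal_re] at h2
  rw [← h2] at h0 h1
  norm_cast at h0 h1
  omega

/-- The Weierstrass function on the real line. -/
noncomputable def realP (x : ℝ) : ℝ := (periods.weierstrassP x).re

lemma coe_realP (x : ℝ) : (realP x : ℂ) = periods.weierstrassP x := by
  refine Complex.conj_eq_iff_re.1 ?_
  rw [← weierstrassP_conj, Complex.conj_ofReal]

lemma coe_realP_half : (realP (1 / 2) : ℂ) = halfValue := by
  rw [coe_realP, halfValue]
  norm_num

lemma exists_hasDerivAt_realP {x : ℝ} (h0 : 0 < x) (h1 : x < 1) : ∃ q : ℝ,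
    HasDerivAt realP q x ∧ q ^ 2 = 4 * realP x * (realP x ^ 2 - realP (1 / 2) ^ 2) := by
  have hx := ofReal_notMem h0 h1
  have hd := (hasDerivAt_weierstrassP hx).real_of_complex
  refine ⟨_, hd, ?_⟩
  have hc : ((-2 * eis 3 x).re : ℂ) = -2 * eis 3 x := by
    have h2 := hd.ofReal_comp
    have h3 : HasDerivAt (fun y : ℝ => periods.weierstrassP y) _ x :=
      h2.congr_of_eventuallyEq (Eventually.of_forall fun y => (coe_realP y).symm)
    exact h3.unique (hasDerivAt_weierstrassP hx).comp_ofReal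
  apply Complex.ofReal_injective
  push_cast
  rw [hc, mul_pow, eis_three_sq hx, coe_realP, coe_realP_half, halfValue_sq]
  ring

lemma realP_half_ne_zero : realP (1 / 2) ≠ 0 := fun h => halfValue_ne_zero (by
  rw [← coe_realP_half, h, Complex.ofReal_zero])

lemma two_mul_ofReal_notMem {x : ℝ} (h0 : 0 < x) (h1 : x < 1 / 2) : 2 * (x : ℂ) ∉ Λ := by
  have := ofReal_notMem (x := 2 * x) (by linarith) (by linarith)
  push_cast at this
  exact this

lemma abs_realP_ne {x : ℝ} (h0 : 0 < x) (h1 : x < 1 / 2) : |realP x| ≠ |realP (1 / 2)| := by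
  have h2 := two_mul_ofReal_notMem h0 h1
  have hhalf : ∀ z : ℂ, 2 * z ∉ Λ → periods.weierstrassP z ≠ halfValue := fun z hz h => by
    have h3 := weierstrassP_product (z := z) (fun h => hz (by rw [two_mul]; exact add_mem h h))
      (fun h => hz (by
        rw [show 2 * z = (z + 1 / 2) + (z + 1 / 2) - 1 by ring]
        exact sub_mem (add_mem h h) one_mem))
    rw [h, sub_self, zero_mul] at h3
    exact mul_ne_zero two_ne_zero (pow_ne_zero 2 halfValue_ne_zero) h3.symm
  intro h
  rcases abs_eq_abs.1 h with h | h
  · exact hhalf x h2 (by rw [← coe_realP, h, coe_realP_half])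
  · refine hhalf (Complex.I * x) ?_ ?_
    · rwa [mul_left_comm, I_mul_mem_iff]
    · rw [weierstrassP_I_mul, ← coe_realP, h, Complex.ofReal_neg, coe_realP_half, neg_neg]

lemma tendsto_realP : Tendsto realP (𝓝[>] 0) atTop := by
  have h1 : Tendsto (fun x : ℝ => (x : ℂ)) (𝓝[>] 0) (𝓝[≠] 0) := by
    refine tendsto_nhdsWithin_iff.2 ⟨?_, ?_⟩
    · have : ContinuousAt (fun x : ℝ => (x : ℂ)) 0 := by fun_prop
      simpa using this.tendsto.mono_left (nhdsWithin_le_nhds (s := Set.Ioi 0))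
    · filter_upwards [self_mem_nhdsWithin] with x hx
      simpa using (ne_of_gt hx)
  have h2 := (Complex.continuous_re.tendsto _).comp (tendsto_sq_mul_weierstrassP.comp h1)
  have h3 : Tendsto (fun x : ℝ => x ^ 2 * realP x) (𝓝[>] 0) (𝓝 1) := by
    refine h2.congr fun x => ?_
    simp only [Function.comp_apply, ← coe_realP]
    norm_cast
  have h4 : Tendsto (fun x : ℝ => (x ^ 2)⁻¹) (𝓝[>] 0) atTop := by
    have := (tendsto_pow_atTop two_ne_zero).comp (tendsto_inv_nhdsGT_zero (𝕜 := ℝ))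
    exact this.congr fun x => by simp
  refine (h3.pos_mul_atTop one_pos h4).congr' ?_
  filter_upwards [self_mem_nhdsWithin] with x hx
  have : x ≠ 0 := ne_of_gt hx
  field_simp

lemma continuousOn_realP : ContinuousOn realP (Set.Ioo 0 1) := fun _ hx =>
  (exists_hasDerivAt_realP hx.1 hx.2).choose_spec.1.continuousAt.continuousWithinAt

lemma abs_half_lt_realP {x : ℝ} (h0 : 0 < x) (h1 : x < 1 / 2) : |realP (1 / 2)| < realP x := by
  by_contra! hx
  obtain ⟨y, hy, hy0, hyx⟩ := ((tendsto_realP.eventually_gt_atTop |realP (1 / 2)|).and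
    (Ioo_mem_nhdsGT h0)).exists
  obtain ⟨w, hw, hw'⟩ := intermediate_value_Icc' hyx.le
    (continuousOn_realP.mono fun w hw => ⟨hy0.trans_le hw.1, by linarith [hw.2]⟩) ⟨hx, hy.le⟩
  exact abs_realP_ne (hy0.trans_le hw.1) (hw.2.trans_lt h1) (by rw [hw', abs_abs])

lemma realP_half_pos : 0 < realP (1 / 2) := by
  have h1 : Tendsto realP (𝓝[<] (1 / 2)) (𝓝 (realP (1 / 2))) :=
    (exists_hasDerivAt_realP (x := 1 / 2) (by norm_num)
      (by norm_num)).choose_spec.1.continuousAt.tendsto.mono_left nhdsWithin_le_nhds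
  have h2 : |realP (1 / 2)| ≤ realP (1 / 2) := ge_of_tendsto h1 (by
    filter_upwards [Ioo_mem_nhdsLT (show (0 : ℝ) < 1 / 2 by norm_num)] with x hx
    exact (abs_half_lt_realP hx.1 hx.2).le)
  exact (abs_pos.2 realP_half_ne_zero).trans_le h2

lemma realP_half_lt {x : ℝ} (h0 : 0 < x) (h1 : x < 1 / 2) : realP (1 / 2) < realP x :=
  (le_abs_self _).trans_lt (abs_half_lt_realP h0 h1)

/-- The change of variables relating the half period to a Beta integral. -/
noncomputable def betaVar (x : ℝ) : ℝ := (realP (1 / 2) / realP x) ^ 2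

lemma betaVar_zero : betaVar 0 = 0 := by
  have : realP 0 = 0 := by simp [realP, periods.weierstrassP_zero]
  simp [betaVar, this]

lemma betaVar_half : betaVar (1 / 2) = 1 := by
  rw [betaVar, div_self realP_half_ne_zero, one_pow]

lemma hasDerivAt_betaVar {x q : ℝ} (hx : realP x ≠ 0) (hq : HasDerivAt realP q x) :
    HasDerivAt betaVar (-2 * realP (1 / 2) ^ 2 * q / realP x ^ 3) x := by
  have h := ((hasDerivAt_const x (realP (1 / 2))).div hq hx).pow 2
  refine h.congr_deriv ?_
  simp only [Pi.div_apply]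
  norm_num
  field_simp

lemma continuousOn_betaVar : ContinuousOn betaVar (Set.Icc 0 (1 / 2)) := by
  intro x hx
  rcases hx.1.eq_or_lt with rfl | h0
  · have h1 : Tendsto betaVar (𝓝[>] 0) (𝓝 0) := by
      have := (tendsto_realP.const_div_atTop (realP (1 / 2))).pow 2
      rw [zero_pow two_ne_zero] at this
      exact this
    have h2 : ContinuousWithinAt betaVar (Set.Ioi 0) 0 := by
      rwa [ContinuousWithinAt, betaVar_zero]
    exact (continuousWithinAt_Ioi_iff_Ici.1 h2).mono Set.Icc_subset_Ici_self
  · obtain ⟨q, hq, -⟩ := exists_hasDerivAt_realP h0 (by linarith [hx.2])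
    have hne : realP x ≠ 0 := by
      rcases hx.2.eq_or_lt with rfl | h1
      · exact realP_half_ne_zero
      · exact (realP_half_pos.trans (realP_half_lt h0 h1)).ne'
    exact (hasDerivAt_betaVar hne hq).continuousAt.continuousWithinAt

lemma betaVar_mem {x : ℝ} (hx : x ∈ Set.Ioo (0 : ℝ) (1 / 2)) : betaVar x ∈ Set.Ioo (0 : ℝ) 1 := by
  have h1 := realP_half_pos
  have h2 := realP_half_lt hx.1 hx.2
  have h3 : 0 < realP (1 / 2) / realP x := div_pos h1 (h1.trans h2)
  have h4 : realP (1 / 2) / realP x < 1 := (div_lt_one (h1.trans h2)).2 h2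
  exact ⟨pow_pos h3 2, pow_lt_one₀ h3.le h4 two_ne_zero⟩

lemma image_betaVar : betaVar '' Set.Ioo 0 (1 / 2) = Set.Ioo 0 1 := by
  refine Set.Subset.antisymm (Set.image_subset_iff.2 fun x hx => betaVar_mem hx) ?_
  have := intermediate_value_Ioo (by norm_num) continuousOn_betaVar
  rwa [betaVar_zero, betaVar_half] at this

lemma exists_hasDerivAt_betaVar {x : ℝ} (hx : x ∈ Set.Ioo (0 : ℝ) (1 / 2)) :
    ∃ t : ℝ, HasDerivAt betaVar t x ∧ t ≠ 0 ∧
      |t| * (betaVar x ^ (-(3 / 4) : ℝ) * (1 - betaVar x) ^ (-(1 / 2) : ℝ)) =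
        4 * √(realP (1 / 2)) := by
  obtain ⟨q, hq, hq2⟩ := exists_hasDerivAt_realP hx.1 (by linarith [hx.2])
  have hh := realP_half_lt hx.1 hx.2
  have hb := realP_half_pos
  have ha := hb.trans hh
  obtain ⟨r, hr, hra⟩ : ∃ r : ℝ, 0 < r ∧ realP x = r ^ 2 :=
    ⟨√(realP x), Real.sqrt_pos.2 ha, (Real.sq_sqrt ha.le).symm⟩
  obtain ⟨c, hc, hca⟩ : ∃ c : ℝ, 0 < c ∧ realP (1 / 2) = c ^ 2 :=
    ⟨√(realP (1 / 2)), Real.sqrt_pos.2 hb, (Real.sq_sqrt hb.le).symm⟩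
  have hd : 0 < realP x ^ 2 - realP (1 / 2) ^ 2 := by nlinarith
  obtain ⟨s, hs, hsa⟩ : ∃ s : ℝ, 0 < s ∧ realP x ^ 2 - realP (1 / 2) ^ 2 = s ^ 2 :=
    ⟨√(realP x ^ 2 - realP (1 / 2) ^ 2), Real.sqrt_pos.2 hd, (Real.sq_sqrt hd.le).symm⟩
  have hqa : |q| = 2 * r * s := by
    rw [← abs_of_pos (show 0 < 2 * r * s by positivity)]
    refine sq_eq_sq_iff_abs_eq_abs _ _ |>.1 ?_
    rw [hq2, hsa, hra]
    ring
  have hq0 : q ≠ 0 := abs_pos.1 (hqa ▸ (by positivity))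
  refine ⟨_, hasDerivAt_betaVar ha.ne' hq, ?_, ?_⟩
  · have h1 := ha.ne'
    have h2 := hb.ne'
    positivity
  · have h1 : betaVar x ^ (-(3 / 4) : ℝ) = ((c / r) ^ 3)⁻¹ := by
      rw [betaVar, hca, hra, show (c ^ 2 / r ^ 2) ^ 2 = (c / r) ^ (4 : ℝ) by
        rw [show (4 : ℝ) = (4 : ℕ) by norm_num, Real.rpow_natCast]; field_simp,
        ← Real.rpow_mul (by positivity), ← Real.rpow_natCast, ← Real.rpow_neg (by positivity)]
      norm_num
    have h2 : (1 - betaVar x) ^ (-(1 / 2) : ℝ) = (s / r ^ 2)⁻¹ := by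
      have h3 : 1 - betaVar x = (s / r ^ 2) ^ (2 : ℝ) := by
        rw [show (2 : ℝ) = (2 : ℕ) by norm_num, Real.rpow_natCast, div_pow, ← hsa, ← hra, betaVar]
        field_simp
      rw [h3, ← Real.rpow_mul (by positivity), ← Real.rpow_neg_one]
      norm_num
    rw [h1, h2, abs_div, abs_mul, hqa, hca, hra, Real.sqrt_sq hc.le,
      abs_of_pos (show 0 < (r ^ 2) ^ 3 by positivity), abs_mul, abs_neg,
      abs_of_pos (show (0 : ℝ) < 2 by norm_num), abs_of_pos (show 0 < (c ^ 2) ^ 2 by positivity)]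
    field_simp
    norm_num

lemma injOn_betaVar : Set.InjOn betaVar (Set.Ioo 0 (1 / 2)) := by
  have key : ∀ x ∈ Set.Ioo (0 : ℝ) (1 / 2), ∀ y ∈ Set.Ioo (0 : ℝ) (1 / 2), x < y →
      betaVar x ≠ betaVar y := by
    intro x hx y hy hxy h
    obtain ⟨w, hw, hw0⟩ := exists_deriv_eq_zero hxy
      (continuousOn_betaVar.mono (Set.Icc_subset_Icc hx.1.le hy.2.le)) h
    obtain ⟨t, ht, ht0, -⟩ := exists_hasDerivAt_betaVar ⟨hx.1.trans hw.1, hw.2.trans hy.2⟩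
    exact ht0 (ht.deriv.symm.trans hw0)
  intro x hx y hy h
  rcases lt_trichotomy x y with hxy | hxy | hxy
  · exact absurd h (key x hx y hy hxy)
  · exact hxy
  · exact absurd h.symm (key y hy x hx hxy)

lemma integral_betaVar :
    ∫ x in Set.Ioo (0 : ℝ) 1, x ^ (-(3 / 4) : ℝ) * (1 - x) ^ (-(1 / 2) : ℝ) =
      2 * √(realP (1 / 2)) := by
  rw [← image_betaVar, MeasureTheory.integral_image_eq_integral_abs_deriv_smul measurableSet_Ioo
    (fun x hx => (exists_hasDerivAt_betaVar hx).choose_spec.1.differentiableAt.hasDerivAt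
      |>.hasDerivWithinAt) injOn_betaVar,
    MeasureTheory.setIntegral_congr_fun (g := fun _ => 4 * √(realP (1 / 2))) measurableSet_Ioo]
  · simp
    ring
  · intro x hx
    obtain ⟨t, ht, -, h⟩ := exists_hasDerivAt_betaVar hx
    simp only [smul_eq_mul, ht.deriv, h]

lemma realP_half : realP (1 / 2) = Real.Gamma (1 / 4) ^ 4 / (8 * π) := by
  have h1 : ProbabilityTheory.beta (1 / 4) (1 / 2) = 2 * √(realP (1 / 2)) := by
    rw [← integral_betaVar, ProbabilityTheory.beta_eq_betaIntegralReal _ _ (by norm_num)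
      (by norm_num), Complex.betaIntegral, intervalIntegral.integral_of_le zero_le_one,
      MeasureTheory.integral_Ioc_eq_integral_Ioo]
    have h2 : ∀ x ∈ Set.Ioo (0 : ℝ) 1, (x : ℂ) ^ ((1 / 4 : ℝ) - 1 : ℂ) *
        (1 - x : ℂ) ^ ((1 / 2 : ℝ) - 1 : ℂ) =
        ((x ^ (-(3 / 4) : ℝ) * (1 - x) ^ (-(1 / 2) : ℝ) : ℝ) : ℂ) := fun x hx => by
      rw [Complex.ofReal_mul, Complex.ofReal_cpow hx.1.le,
        Complex.ofReal_cpow (by linarith [hx.2])]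
      push_cast
      norm_num
    rw [MeasureTheory.setIntegral_congr_fun measurableSet_Ioo h2, integral_complex_ofReal,
      Complex.ofReal_re]
  have hG := Real.Gamma_mul_Gamma_one_sub (1 / 4)
  rw [show π * (1 / 4) = π / 4 by ring, Real.sin_pi_div_four] at hG
  norm_num [ProbabilityTheory.beta, -one_div] at h1 hG
  have h34 : Real.Gamma (3 / 4) ≠ 0 := (Real.Gamma_pos_of_pos (by norm_num)).ne'
  have h3 := congrArg (· ^ 2) h1
  have h4 := congrArg (· ^ 2) hG
  simp only [mul_pow, div_pow, Real.sq_sqrt realP_half_pos.le, Real.sq_sqrt zero_le_two,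
    Real.Gamma_one_half_eq, Real.sq_sqrt Real.pi_pos.le] at h3 h4
  have hpi := Real.pi_ne_zero
  rw [div_eq_iff (pow_ne_zero 2 h34)] at h3
  rw [eq_div_iff (by positivity)]
  field_simp at h4
  refine mul_right_cancel₀ (pow_ne_zero 2 h34) ?_
  linear_combination (-2 * π) * h3 - Real.Gamma (1 / 4) ^ 2 * h4

lemma latticeSum_four : G₄ = halfValue ^ 2 / 15 := by
  rw [halfValue_sq]
  ring

lemma mix_combination_half : 4 * eis 6 (1 / 2) + 8 * (mix 8 2 (1 / 2) / π ^ 2)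
      + 4 * (mix 10 4 (1 / 2) / π ^ 4) - 8 * (mix 9 1 (1 / 2) / π) + eis 10 (1 / 2) =
    16384 / 362880 * (567 / 16 * halfValue ^ 3 + 117 / 8 * halfValue ^ 5 / π ^ 2
      - 297 / 16 * halfValue ^ 5 / π + 189 / 64 * halfValue ^ 5
      + 3 / 2 * halfValue ^ 7 / π ^ 4) := by
  have hpi : (π : ℂ) ≠ 0 := Complex.ofReal_ne_zero.2 Real.pi_ne_zero
  have h1 : π * A₁ = (65 * G₁₂ - 10 * G₄ * G₈) / 10 := by
    linear_combination (-1 / 10 : ℂ) * mix_ten_one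
  have h2 : π ^ 2 * A₂ = (2 * G₄ * G₈ - 2 * G₁₂ - 165 * G₁₂ + 90 * ((65 * G₁₂ - 10 * G₄ * G₈) / 10)
      + 11 * G₁₂ - 14 * G₄ * G₈ + 3 * (G₄ ^ 2 - 2 * G₈) * G₄) / 9 := by
    linear_combination (-1 / 9 : ℂ) * mix_nine_two + 10 * h1
  have h3 := mix_ten_four _ half_notMem
  rw [show 12 * G₄ * G₈ - 4 * G₄ ^ 3 - 4 * G₁₂ + 55 * G₁₂ - 40 * π * A₁ + 6 * π ^ 2 * A₂ =
    12 * G₄ * G₈ - 4 * G₄ ^ 3 - 4 * G₁₂ + 55 * G₁₂ - 40 * (π * A₁) + 6 * (π ^ 2 * A₂) by ring,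
    h2, h1] at h3
  rw [h3, mix_nine_one _ half_notMem, mix_eight_two _ half_notMem, eis_six half_notMem,
    eis_ten half_notMem, eis_fourteen half_notMem, latticeSum_twelve, latticeSum_eight,
    latticeSum_four, ← halfValue]
  field_simp
  ring

/-- Rotation by a quarter turn of the half-integral points of the plane. -/
def quarterTurn (p : ℤ × ℤ) : ℤ × ℤ := (-p.2 - 1, p.1)

/-- A parametrisation of the pairs of integers with odd sum. -/
def oddPair (p : ℤ × ℤ) : ℤ × ℤ := (-p.1 - p.2 - 1, p.1 - p.2)

lemma quarterTurn_injective : Function.Injective quarterTurn := fun p q h => by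
  simp only [quarterTurn, Prod.mk.injEq] at h
  ext <;> omega

lemma oddPair_injective : Function.Injective oddPair := fun p q h => by
  simp only [oddPair, Prod.mk.injEq] at h
  ext <;> omega

lemma mem_range_oddPair (p : ℤ × ℤ) : p ∈ Set.range oddPair ↔ Odd (p.1 + p.2) := by
  constructor
  · rintro ⟨q, rfl⟩
    exact ⟨-q.2 - 1, by simp only [oddPair]; ring⟩
  · rintro ⟨k, hk⟩
    exact ⟨(p.2 - k - 1, -k - 1), by simp only [oddPair]; ext <;> simp only <;> omega⟩

lemma mem_range_quarterTurn_oddPair (p : ℤ × ℤ) :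
    p ∈ Set.range (quarterTurn ∘ oddPair) ↔ Even (p.1 + p.2) := by
  constructor
  · rintro ⟨q, rfl⟩
    exact ⟨-q.1 - 1, by simp only [oddPair, quarterTurn, Function.comp_apply]; ring⟩
  · rintro ⟨k, hk⟩
    exact ⟨(-k - 1, k - p.2), by
      simp only [oddPair, quarterTurn, Function.comp_apply]; ext <;> simp only <;> omega⟩

lemma hasSum_of_quarterTurn {f : ℤ × ℤ → ℂ} (hf : ∀ p, f (quarterTurn p) = f p) {s : ℂ}
    (h : HasSum (f ∘ oddPair) s) : HasSum f (2 * s) := by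
  have h1 : HasSum (f ∘ ((↑) : Set.range oddPair → ℤ × ℤ)) s :=
    oddPair_injective.hasSum_range_iff.2 h
  have h2 : HasSum (f ∘ ((↑) : Set.range (quarterTurn ∘ oddPair) → ℤ × ℤ)) s :=
    (quarterTurn_injective.comp oddPair_injective).hasSum_range_iff.2
      (h.congr_fun fun p => hf _)
  rw [two_mul]
  refine h1.add_isCompl ?_ h2
  have : Set.range (quarterTurn ∘ oddPair) = (Set.range oddPair)ᶜ := by
    ext p
    rw [Set.mem_compl_iff, mem_range_oddPair, mem_range_quarterTurn_oddPair, Int.not_odd_iff_even]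
  rw [this]
  exact isCompl_compl

lemma tsum_int_eq {g : ℤ → ℂ} (hg : Summable g) :
    ∑' n, g n = ∑' n : ℕ, (g n + g (-(n : ℤ) - 1)) := by
  have h1 : Summable fun n : ℕ => g n := hg.comp_injective Nat.cast_injective
  have h2 : Summable fun n : ℕ => g (-(n + 1 : ℤ)) :=
    hg.comp_injective (i := fun n : ℕ => -(n + 1 : ℤ)) fun a b h => by simpa using h
  rw [tsum_of_nat_of_neg_add_one h1 h2, ← h1.tsum_add h2]
  simp only [neg_add']

lemma tsum_quadrant {f : ℤ × ℤ → ℂ} (hf : ∀ p, f (quarterTurn p) = f p) (hs : Summable f) :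
    ∑' p, f p = 4 * ∑' p : ℕ × ℕ, f (p.1, p.2) := by
  have hinj : Function.Injective fun p : ℕ × ℕ => ((p.1 : ℤ), (p.2 : ℤ)) := fun p q h => by
    simpa [Prod.ext_iff] using h
  have hsN : Summable fun p : ℕ × ℕ => f (p.1, p.2) := hs.comp_injective hinj
  have h1 : ∀ m n : ℤ, f (m, -n - 1) = f (n, m) := fun m n => by
    simpa [quarterTurn] using (hf (m, -n - 1)).symm
  have h2 : ∀ m n : ℤ, f (-m - 1, n) = f (n, m) := fun m n => hf (n, m)
  have hsw : Summable fun p : ℕ × ℕ => f (p.2, p.1) := (Equiv.prodComm ℕ ℕ).summable_iff.2 hsN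
  have hsw' : ∑' p : ℕ × ℕ, f (p.2, p.1) = ∑' p : ℕ × ℕ, f (p.1, p.2) :=
    (Equiv.prodComm ℕ ℕ).tsum_eq fun p : ℕ × ℕ => f (p.1, p.2)
  have h3 : ∀ m : ℤ, ∑' n : ℤ, f (m, n) = ∑' n : ℕ, (f (m, n) + f (n, m)) := fun m => by
    rw [tsum_int_eq (hs.prod_factor m)]
    simp only [h1]
  rw [hs.tsum_prod, tsum_int_eq hs.prod]
  have h4 : ∀ m : ℕ, ∑' n : ℤ, f (m, n) + ∑' n : ℤ, f (-(m : ℤ) - 1, n) =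
      2 * ∑' n : ℕ, (f (m, n) + f (n, m)) := fun m => by
    rw [h3, h3, two_mul]
    congr 1
    refine tsum_congr fun n => ?_
    rw [h2, h1, add_comm]
  simp only [h4]
  rw [tsum_mul_left, ← (hsN.add hsw).tsum_prod (f := fun p : ℕ × ℕ => f (p.1, p.2) + f (p.2, p.1)),
    hsN.tsum_add hsw, hsw']
  ring

/-- The terms of the double series expansion of the integral. -/
noncomputable def cosTerm (p : ℤ × ℤ) : ℂ :=
  (-1) ^ (p.1 + p.2) * (p.1 * (p.1 + 1) * (p.2 * (p.2 + 1))) /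
    ((p.1 + 1 / 2) * (1 - Complex.I) + (p.2 + 1 / 2) * (1 + Complex.I)) ^ 10

/-- The same terms in lattice coordinates. -/
noncomputable def latticeTerm (v : ℂ) : ℂ :=
  (4 * v ^ 4 + 8 * v ^ 2 * (starRingEnd ℂ) v ^ 2 + 4 * (starRingEnd ℂ) v ^ 4
    - 8 * v * (starRingEnd ℂ) v + 1) / v ^ 10

lemma cosTerm_quarterTurn (p : ℤ × ℤ) : cosTerm (quarterTurn p) = cosTerm p := by
  have hI : Complex.I ^ 10 = -1 := by
    rw [show 10 = 2 * 5 by norm_num, pow_mul, Complex.I_sq]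
    norm_num
  have h1 : (-1 : ℂ) ^ (-p.2 - 1 + p.1) = -(-1) ^ (p.1 + p.2) := by
    rcases Int.even_or_odd (p.1 + p.2) with h | h
    · rw [h.neg_one_zpow, Odd.neg_one_zpow]
      grind
    · rw [h.neg_one_zpow, Even.neg_one_zpow, neg_neg]
      grind
  simp only [cosTerm, quarterTurn, h1]
  push_cast
  rw [show ((-p.2 - 1 + 1 / 2 : ℂ) * (1 - Complex.I) + (p.1 + 1 / 2) * (1 + Complex.I)) =
    Complex.I * ((p.1 + 1 / 2) * (1 - Complex.I) + (p.2 + 1 / 2) * (1 + Complex.I)) by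
      linear_combination (p.1 - p.2 : ℂ) * Complex.I_mul_I, mul_pow, hI]
  rw [neg_one_mul, div_neg, ← neg_div]
  congr 1
  ring

lemma cosTerm_oddPair (p : ℤ × ℤ) :
    cosTerm (oddPair p) = latticeTerm (1 / 2 + (p.1 + p.2 * Complex.I)) / 16384 := by
  have hI : Complex.I ^ 10 = -1 := by
    rw [show 10 = 2 * 5 by norm_num, pow_mul, Complex.I_sq]
    norm_num
  have h1 : (-1 : ℂ) ^ (-p.1 - p.2 - 1 + (p.1 - p.2)) = -1 :=
    Odd.neg_one_zpow ⟨-p.2 - 1, by ring⟩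
  simp only [cosTerm, oddPair, h1, latticeTerm, map_add, map_mul, Complex.conj_I, map_intCast,
    map_div₀, map_one, map_ofNat]
  push_cast
  rw [show ((-p.1 - p.2 - 1 + 1 / 2 : ℂ) * (1 - Complex.I) + (p.1 - p.2 + 1 / 2) * (1 + Complex.I)) =
    2 * Complex.I * (1 / 2 + (p.1 + p.2 * Complex.I)) by
      linear_combination (-2 * p.2 : ℂ) * Complex.I_mul_I, mul_pow, mul_pow, hI]
  have h2 : 4 * (1 / 2 + (p.1 + p.2 * Complex.I)) ^ 4 +
      8 * (1 / 2 + (p.1 + p.2 * Complex.I)) ^ 2 * (1 / 2 + (p.1 + p.2 * -Complex.I)) ^ 2 +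
      4 * (1 / 2 + (p.1 + p.2 * -Complex.I)) ^ 4 -
      8 * (1 / 2 + (p.1 + p.2 * Complex.I)) * (1 / 2 + (p.1 + p.2 * -Complex.I)) + 1 =
      16 * ((-p.1 - p.2 - 1) * (-p.1 - p.2 - 1 + 1) * ((p.1 - p.2) * (p.1 - p.2 + 1)) : ℂ) := by
    linear_combination (16 * (p.2 : ℂ) ^ 2 * (2 * (p.1 + 1 / 2) ^ 2 +
      p.2 ^ 2 * Complex.I ^ 2 - p.2 ^ 2) + 8 * p.2 ^ 2) * Complex.I_mul_I
  rw [h2]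
  generalize (1 / 2 + (p.1 + p.2 * Complex.I) : ℂ) ^ 10 = D
  generalize ((-p.1 - p.2 - 1) * (-p.1 - p.2 - 1 + 1) * ((p.1 - p.2) * (p.1 - p.2 + 1)) : ℂ) = X
  ring

lemma sum_half {k j : ℕ} (h : j + 3 ≤ k) :
    Summable fun l : Λ => (starRingEnd ℂ) (1 / 2 + l) ^ j / (1 / 2 + l : ℂ) ^ k := by
  have h1 := summable (admissible_one (k := k - j) (by omega))
    (regular_of_notMem half_notMem)
  refine h1.norm.of_norm_bounded fun l => ?_
  have h2 : ‖(1 / 2 + l : ℂ)‖ ≠ 0 := norm_ne_zero_iff.2 (add_ne_zero_of_notMem half_notMem l)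
  rw [norm_div, norm_pow, norm_pow, Complex.norm_conj, norm_div, norm_one, norm_pow,
    div_le_div_iff₀ (by positivity) (by positivity), one_mul, ← pow_add]
  exact le_of_eq (congrArg _ (by omega))

lemma hasSum_latticeTerm : HasSum (fun l : Λ => latticeTerm (1 / 2 + l))
    (4 * eis 6 (1 / 2) + 8 * (mix 8 2 (1 / 2) / π ^ 2) + 4 * (mix 10 4 (1 / 2) / π ^ 4)
      - 8 * (mix 9 1 (1 / 2) / π) + eis 10 (1 / 2)) := by
  have hpi : (π : ℂ) ≠ 0 := Complex.ofReal_ne_zero.2 Real.pi_ne_zero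
  have hE : ∀ k : ℕ, 3 ≤ k → HasSum (fun l : Λ => 1 / (1 / 2 + l : ℂ) ^ k) (eis k (1 / 2)) :=
    fun k hk => (summable (admissible_one hk) (regular_of_notMem half_notMem)).hasSum
  have hM : ∀ k j : ℕ, j + 3 ≤ k → HasSum (fun l : Λ => (starRingEnd ℂ) (1 / 2 + l) ^ j /
      (1 / 2 + l : ℂ) ^ k) (mix k j (1 / 2) / π ^ j) := fun k j h => by
    rw [mix_half, mul_div_cancel_left₀ _ (pow_ne_zero _ hpi)]
    exact (sum_half h).hasSum
  have h1 := hM 9 1 (by norm_num)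
  rw [pow_one (π : ℂ)] at h1
  refine ((((((hE 6 (by norm_num)).mul_left 4).add ((hM 8 2 (by norm_num)).mul_left 8)).add
    ((hM 10 4 (by norm_num)).mul_left 4)).sub (h1.mul_left 8)).add
    (hE 10 (by norm_num))).congr_fun fun l => ?_
  have h2 : (1 / 2 + l : ℂ) ≠ 0 := add_ne_zero_of_notMem half_notMem l
  rw [latticeTerm]
  generalize (starRingEnd ℂ) (1 / 2 + l) = w
  generalize (1 / 2 + l : ℂ) = v at h2 ⊢
  field_simp

lemma tsum_cosTerm : ∑' p : ℕ × ℕ, cosTerm (p.1, p.2) =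
    (4 * eis 6 (1 / 2) + 8 * (mix 8 2 (1 / 2) / π ^ 2) + 4 * (mix 10 4 (1 / 2) / π ^ 4)
      - 8 * (mix 9 1 (1 / 2) / π) + eis 10 (1 / 2)) / 32768 := by
  have h1 := hasSum_latticeTerm.div_const 16384
  rw [← periods.latticeEquivProd.symm.toEquiv.hasSum_iff] at h1
  have h2 := hasSum_of_quarterTurn cosTerm_quarterTurn (h1.congr_fun fun p => by
    have h3 : ((periods.latticeEquivProd.symm.toEquiv p : Λ) : ℂ) = p.1 + p.2 * Complex.I :=
      (periods.latticeEquiv_symm_apply p).trans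
        (congrArg (· + (p.2 * Complex.I : ℂ)) (mul_one (p.1 : ℂ)))
    simp only [Function.comp_apply, cosTerm_oddPair, h3])
  have h3 := tsum_quadrant cosTerm_quarterTurn h2.summable
  rw [h2.tsum_eq] at h3
  linear_combination (-1 / 4 : ℂ) * h3

lemma integrableOn_pow_mul_exp (n : ℕ) {s : ℂ} (hs : 0 < s.re) :
    MeasureTheory.IntegrableOn (fun x : ℝ => (x : ℂ) ^ n * Complex.exp (-s * x))
      (Set.Ioi 0) := by
  have h1 := integrableOn_rpow_mul_exp_neg_mul_rpow (p := 1) (s := n) (b := s.re)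
    (by linarith [Nat.cast_nonneg (α := ℝ) n]) one_pos hs
  refine MeasureTheory.Integrable.mono h1 (by fun_prop) ?_
  filter_upwards with x
  simp [Complex.norm_exp]

lemma tendsto_pow_mul_exp (n : ℕ) {s : ℂ} (hs : 0 < s.re) :
    Tendsto (fun x : ℝ => (x : ℂ) ^ n * Complex.exp (-s * x)) atTop (𝓝 0) := by
  rw [tendsto_zero_iff_norm_tendsto_zero]
  have h1 := (tendsto_rpow_mul_exp_neg_mul_atTop_nhds_zero n s.re hs).norm
  rw [norm_zero] at h1
  refine h1.congr fun x => ?_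
  simp [Complex.norm_exp]

lemma integral_pow_mul_exp (n : ℕ) {s : ℂ} (hs : 0 < s.re) :
    ∫ x in Set.Ioi (0 : ℝ), (x : ℂ) ^ n * Complex.exp (-s * x) =
      (n.factorial : ℂ) / s ^ (n + 1) := by
  have hs0 : s ≠ 0 := fun h => by simp [h] at hs
  have hexp : ∀ x : ℝ, HasDerivAt (fun x : ℝ => Complex.exp (-s * x))
      (Complex.exp (-s * x) * -s) x := fun x => by
    simpa using ((hasDerivAt_id (x : ℂ)).const_mul (-s)).cexp.comp_ofReal
  induction n with
  | zero =>
    have h2 : MeasureTheory.IntegrableOn (fun x : ℝ => Complex.exp (-s * x) * -s) (Set.Ioi 0) := by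
      have h3 := (integrableOn_pow_mul_exp 0 hs).mul_const (-s)
      simp only [pow_zero, one_mul] at h3
      exact h3
    have h1 := MeasureTheory.integral_Ioi_of_hasDerivAt_of_tendsto' (fun x _ => hexp x) h2
      (by simpa using tendsto_pow_mul_exp 0 hs)
    rw [MeasureTheory.integral_mul_const] at h1
    simp only [pow_zero, one_mul, Nat.factorial_zero, Nat.cast_one, zero_add, pow_one]
    rw [eq_div_iff hs0]
    simpa using h1
  | succ n ih =>
    have hpow : ∀ x : ℝ, HasDerivAt (fun x : ℝ => (x : ℂ) ^ (n + 1)) ((n + 1) * (x : ℂ) ^ n) x :=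
      fun x => by simpa using (hasDerivAt_pow (n + 1) (x : ℂ)).comp_ofReal
    have h2 := (integrableOn_pow_mul_exp n hs).const_mul ((n : ℂ) + 1)
    have h3 := (integrableOn_pow_mul_exp (n + 1) hs).mul_const (-s)
    have h1 := MeasureTheory.integral_Ioi_of_hasDerivAt_of_tendsto' (a := (0 : ℝ))
      (f' := fun x : ℝ => (n + 1) * ((x : ℂ) ^ n * Complex.exp (-s * x)) +
        (x : ℂ) ^ (n + 1) * Complex.exp (-s * x) * -s)
      (fun x _ => ((hpow x).mul (hexp x)).congr_deriv (by ring))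
      (h2.add h3) (tendsto_pow_mul_exp (n + 1) hs)
    rw [MeasureTheory.integral_add h2 h3, MeasureTheory.integral_const_mul,
      MeasureTheory.integral_mul_const, ih] at h1
    simp only [Pi.mul_apply, Complex.ofReal_zero, ne_eq, Nat.add_eq_zero_iff, one_ne_zero, and_false,
      not_false_eq_true, zero_pow, zero_mul, sub_zero] at h1
    rw [Nat.factorial_succ, eq_div_iff (pow_ne_zero _ hs0)]
    push_cast
    generalize (∫ x in Set.Ioi (0 : ℝ), (x : ℂ) ^ (n + 1) * Complex.exp (-s * x)) = J at h1 ⊢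
    field_simp at h1
    linear_combination (-1 : ℂ) * h1

lemma integral_norm_pow_mul_exp (n : ℕ) {s : ℂ} (hs : 0 < s.re) :
    ∫ x in Set.Ioi (0 : ℝ), ‖(x : ℂ) ^ n * Complex.exp (-s * x)‖ =
      (n.factorial : ℝ) / s.re ^ (n + 1) := by
  have h1 := integral_pow_mul_exp n (s := (s.re : ℂ)) (by simpa using hs)
  apply Complex.ofReal_injective
  rw [← integral_complex_ofReal]
  push_cast
  rw [← h1]
  refine MeasureTheory.setIntegral_congr_fun measurableSet_Ioi fun x hx => ?_
  have hx' : 0 < x := hx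
  simp [Complex.norm_exp, abs_of_pos hx']

/-- The exponents in the double series expansion of the integrand. -/
noncomputable def rate (p : ℕ × ℕ) : ℂ :=
  (p.1 + 3 / 2) * (1 - Complex.I) + (p.2 + 3 / 2) * (1 + Complex.I)

lemma rate_re (p : ℕ × ℕ) : (rate p).re = p.1 + p.2 + 3 := by
  simp [rate]
  ring

/-- The coefficients in the double series expansion of the integrand. -/
noncomputable def coefficient (p : ℕ × ℕ) : ℂ :=
  8 * ((-1) ^ p.1 * ((p.1 + 2).choose 2 : ℕ)) * ((-1) ^ p.2 * ((p.2 + 2).choose 2 : ℕ))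

lemma exp_neg_one_sub_I_mul (x : ℂ) : Complex.exp (-(1 - Complex.I) * x) =
    (Complex.exp x)⁻¹ * Complex.exp (x * Complex.I) := by
  rw [← Complex.exp_neg, ← Complex.exp_add]
  ring_nf

lemma exp_neg_one_add_I_mul (x : ℂ) : Complex.exp (-(1 + Complex.I) * x) =
    (Complex.exp x)⁻¹ * (Complex.exp (x * Complex.I))⁻¹ := by
  rw [← Complex.exp_neg, ← Complex.exp_neg, ← Complex.exp_add]
  ring_nf

lemma cos_add_cosh (x : ℂ) : Complex.cos x + Complex.cosh x = Complex.exp x *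
    ((1 - -Complex.exp (-(1 - Complex.I) * x)) *
      (1 - -Complex.exp (-(1 + Complex.I) * x))) / 2 := by
  have hE : Complex.exp x ≠ 0 := Complex.exp_ne_zero _
  have hU : Complex.exp (x * Complex.I) ≠ 0 := Complex.exp_ne_zero _
  rw [Complex.cos, Complex.cosh, exp_neg_one_sub_I_mul, exp_neg_one_add_I_mul, neg_mul,
    Complex.exp_neg, Complex.exp_neg]
  field_simp
  ring

lemma div_cos_add_cosh_cubed (x : ℂ) : 8 * x ^ 9 * Complex.exp (-3 * x) *
    (1 / (1 - -Complex.exp (-(1 - Complex.I) * x)) ^ (2 + 1) *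
      (1 / (1 - -Complex.exp (-(1 + Complex.I) * x)) ^ (2 + 1))) =
    x ^ 9 / (Complex.cos x + Complex.cosh x) ^ 3 := by
  have hc : Complex.exp (-3 * x) = (Complex.exp x ^ 3)⁻¹ := by
    rw [← Complex.exp_nat_mul, ← Complex.exp_neg]
    push_cast
    ring_nf
  rw [cos_add_cosh, hc]
  generalize 1 - -Complex.exp (-(1 - Complex.I) * x) = u
  generalize 1 - -Complex.exp (-(1 + Complex.I) * x) = v
  generalize Complex.exp x = w
  rw [div_pow, mul_pow, mul_pow]
  simp only [div_eq_mul_inv, mul_inv, inv_inv]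
  ring

lemma exp_neg_rate_mul (p : ℕ × ℕ) (x : ℂ) : Complex.exp (-rate p * x) = Complex.exp (-3 * x) *
    (Complex.exp (-(1 - Complex.I) * x) ^ p.1 * Complex.exp (-(1 + Complex.I) * x) ^ p.2) := by
  rw [← Complex.exp_nat_mul, ← Complex.exp_nat_mul, ← Complex.exp_add, ← Complex.exp_add, rate]
  ring_nf

lemma hasSum_mul {f g : ℕ → ℂ} {a b : ℂ} (hf : HasSum f a) (hg : HasSum g b) :
    HasSum (fun p : ℕ × ℕ => f p.1 * g p.2) (a * b) :=
  hf.mul hg (summable_mul_of_summable_norm hf.summable.norm hg.summable.norm)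

lemma hasSum_integrand {x : ℝ} (hx : 0 < x) :
    HasSum (fun p : ℕ × ℕ => coefficient p * ((x : ℂ) ^ 9 * Complex.exp (-rate p * x)))
      ((x ^ 9 / (Real.cos x + Real.cosh x) ^ 3 : ℝ) : ℂ) := by
  have hA : ‖-Complex.exp (-(1 - Complex.I) * x)‖ < 1 := by
    simpa [Complex.norm_exp] using hx
  have hB : ‖-Complex.exp (-(1 + Complex.I) * x)‖ < 1 := by
    simpa [Complex.norm_exp] using hx
  have h1 := hasSum_choose_mul_geometric_of_norm_lt_one 2 hA
  have h2 := hasSum_choose_mul_geometric_of_norm_lt_one 2 hB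
  have h4 := (hasSum_mul h1 h2).mul_left (8 * (x : ℂ) ^ 9 * Complex.exp (-3 * x))
  rw [div_cos_add_cosh_cubed] at h4
  push_cast
  refine h4.congr_fun fun p => ?_
  rw [exp_neg_rate_mul, coefficient, neg_pow (Complex.exp (-(1 - Complex.I) * x)),
    neg_pow (Complex.exp (-(1 + Complex.I) * x))]
  ring

lemma summable_integral_norm : Summable fun p : ℕ × ℕ =>
    ∫ x in Set.Ioi (0 : ℝ), ‖coefficient p * ((x : ℂ) ^ 9 * Complex.exp (-rate p * x))‖ := by
  have h1 : Summable fun n : ℕ => 1 / ((n : ℝ) + 1) ^ 2 := by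
    simpa using (summable_nat_add_iff 1).2 (Real.summable_one_div_nat_pow.2 one_lt_two)
  refine ((h1.mul_of_nonneg h1 (fun _ => by positivity) (fun _ => by positivity)).mul_left
    (8 * (Nat.factorial 9 : ℝ))).of_nonneg_of_le
    (fun _ => MeasureTheory.integral_nonneg fun _ => norm_nonneg _) fun p => ?_
  have hre : 0 < (rate p).re := by rw [rate_re]; positivity
  have hch : ∀ n : ℕ, (((n + 2).choose 2 : ℕ) : ℝ) ≤ (n + 2) ^ 2 := fun n => by
    exact_mod_cast Nat.choose_le_pow (n + 2) 2
  simp_rw [norm_mul (coefficient p)]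
  rw [MeasureTheory.integral_const_mul, integral_norm_pow_mul_exp 9 hre, rate_re]
  have hn : ‖coefficient p‖ = 8 * ((p.1 + 2).choose 2 : ℕ) * ((p.2 + 2).choose 2 : ℕ) := by
    simp [coefficient, ← mul_assoc]
  rw [hn]
  have hp := hch p.1
  have hq := hch p.2
  have ha : (0 : ℝ) ≤ p.1 := Nat.cast_nonneg _
  have hb : (0 : ℝ) ≤ p.2 := Nat.cast_nonneg _
  generalize (p.1 : ℝ) = a at *
  generalize (p.2 : ℝ) = b at *
  have h2 : (a + 2) ^ 2 * (b + 2) ^ 2 * ((a + 1) ^ 2 * (b + 1) ^ 2) ≤ (a + b + 3) ^ 10 := by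
    calc (a + 2) ^ 2 * (b + 2) ^ 2 * ((a + 1) ^ 2 * (b + 1) ^ 2)
        ≤ (a + b + 3) ^ 2 * (a + b + 3) ^ 2 * ((a + b + 3) ^ 2 * (a + b + 3) ^ 2) := by
          gcongr <;> linarith
      _ = (a + b + 3) ^ 8 := by ring
      _ ≤ (a + b + 3) ^ 10 := pow_le_pow_right₀ (by linarith) (by norm_num)
  calc 8 * (((p.1 + 2).choose 2 : ℕ) : ℝ) * ((p.2 + 2).choose 2 : ℕ) *
        ((Nat.factorial 9 : ℝ) / (a + b + 3) ^ 10)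
      ≤ 8 * (a + 2) ^ 2 * (b + 2) ^ 2 * ((Nat.factorial 9 : ℝ) / (a + b + 3) ^ 10) := by
        gcongr
    _ ≤ 8 * (Nat.factorial 9 : ℝ) * (1 / (a + 1) ^ 2 * (1 / (b + 1) ^ 2)) := by
        have h3 : 0 < (a + 1) ^ 2 * (b + 1) ^ 2 := by positivity
        have h4 : 0 < (a + b + 3) ^ 10 := by positivity
        rw [div_mul_div_comm, one_mul, mul_one_div, ← mul_div_assoc, div_le_div_iff₀ h4 h3]
        have h5 := mul_le_mul_of_nonneg_left h2 (by positivity : 0 ≤ 8 * (Nat.factorial 9 : ℝ))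
        linarith

lemma coefficient_div (p : ℕ × ℕ) :
    coefficient p * ((Nat.factorial 9 : ℂ) / rate p ^ 10) =
      725760 * cosTerm ((p.1 + 1 : ℕ), (p.2 + 1 : ℕ)) := by
  have hch : ∀ n : ℕ, (((n + 2).choose 2 : ℕ) : ℂ) = (n + 2) * (n + 1) / 2 := fun n => by
    rw [Nat.cast_choose_two]
    push_cast
    ring
  have hr : (((p.1 + 1 : ℕ) : ℤ) + 1 / 2 : ℂ) * (1 - Complex.I) +
      (((p.2 + 1 : ℕ) : ℤ) + 1 / 2) * (1 + Complex.I) = rate p := by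
    rw [rate]
    push_cast
    ring
  have hf : (Nat.factorial 9 : ℂ) = 362880 := by norm_num [Nat.factorial]
  have hs : (-1 : ℂ) ^ (((p.1 + 1 : ℕ) : ℤ) + ((p.2 + 1 : ℕ) : ℤ)) = (-1) ^ p.1 * (-1) ^ p.2 := by
    rw [← Nat.cast_add, zpow_natCast]
    ring
  rw [cosTerm, hr, hs, coefficient, hch, hch, hf]
  push_cast
  ring

lemma coe_integral : ((∫ x in Set.Ioi (0 : ℝ), x ^ 9 / (Real.cos x + Real.cosh x) ^ 3 : ℝ) : ℂ) =
    725760 * ∑' p : ℕ × ℕ, cosTerm (p.1, p.2) := by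
  have hre : ∀ p, 0 < (rate p).re := fun p => by rw [rate_re]; positivity
  have h1 := (MeasureTheory.hasSum_integral_of_summable_integral_norm
    (fun p => (integrableOn_pow_mul_exp 9 (hre p)).const_mul (coefficient p))
    summable_integral_norm).tsum_eq
  rw [← integral_complex_ofReal, MeasureTheory.setIntegral_congr_fun measurableSet_Ioi
    fun x hx => (hasSum_integrand hx).tsum_eq.symm, ← h1]
  have h2 : ∀ p : ℕ × ℕ, ∫ x in Set.Ioi (0 : ℝ),
      coefficient p * ((x : ℂ) ^ 9 * Complex.exp (-rate p * x)) =
        725760 * cosTerm ((p.1 + 1 : ℕ), (p.2 + 1 : ℕ)) := fun p => by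
    rw [MeasureTheory.integral_const_mul, integral_pow_mul_exp 9 (hre p), coefficient_div]
  rw [tsum_congr h2, tsum_mul_left]
  congr 1
  have hinj : Function.Injective fun p : ℕ × ℕ => (p.1 + 1, p.2 + 1) := fun p q h => by
    simpa [Prod.ext_iff] using h
  refine hinj.tsum_eq (f := fun p : ℕ × ℕ => cosTerm (p.1, p.2)) fun p hp => ?_
  obtain ⟨m, n⟩ := p
  rcases m with _ | m
  · simp [cosTerm] at hp
  rcases n with _ | n
  · simp [cosTerm] at hp
  exact ⟨(m, n), rfl⟩

end GaussLattice

theorem integral_x9_cos_plus_cosh_cubed :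
    (∫ x in Set.Ioi (0:ℝ), x ^ 9 / (Real.cos x + Real.cosh x) ^ 3) =
      567 * Real.Gamma (1/4) ^ 12 / (2 ^ 13 * π ^ 3)
    + 117 * Real.Gamma (1/4) ^ 20 / (2 ^ 18 * π ^ 7)
    - 297 * Real.Gamma (1/4) ^ 20 / (2 ^ 19 * π ^ 6)
    + 189 * Real.Gamma (1/4) ^ 20 / (2 ^ 21 * π ^ 5)
    + 3 * Real.Gamma (1/4) ^ 28 / (2 ^ 22 * π ^ 11) := by
  have h : (∫ x in Set.Ioi (0:ℝ), x ^ 9 / (Real.cos x + Real.cosh x) ^ 3) =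
      567 / 16 * GaussLattice.realP (1 / 2) ^ 3 + 117 / 8 * GaussLattice.realP (1 / 2) ^ 5 / π ^ 2
        - 297 / 16 * GaussLattice.realP (1 / 2) ^ 5 / π + 189 / 64 * GaussLattice.realP (1 / 2) ^ 5
        + 3 / 2 * GaussLattice.realP (1 / 2) ^ 7 / π ^ 4 := by
    apply Complex.ofReal_injective
    rw [GaussLattice.coe_integral, GaussLattice.tsum_cosTerm, GaussLattice.mix_combination_half,
      ← GaussLattice.coe_realP_half]
    push_cast
    ring
  rw [h, GaussLattice.realP_half]
  have hpi := Real.pi_ne_zero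
  field_simp
  ring
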